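/- arXiv:1602.02576 — 2 statements merged into one kernel-verified Lean document; each statement's English description precedes it below -/
import Mathlib

section
/- Let L = F_q with q = 2^n and let f(x) = x^{2^k+1} + g(x) ∈ L[x], where g(x) = Σ_{j=0}^{2^{k-1}+1} a_j x^j has degree at most 2^{k-1}+1. Suppose there exists an index j ≥ 3 with a_j ≠ 0 such that φ_j(x,y,z) is absolutely irreducible. Then φ(x,y,z) is absolutely irreducible, and consequently f is not exceptional APN. -/
open MvPolynomial

/-- A function `f : L → L` on a finite field is APN (almost perfect nonlinear) if
for all `a ≠ 0` and all `b`, the equation `f (x + a) + f x = b` has at most 2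
solutions `x` (in characteristic 2, `+` and `-` coincide). -/
def IsAPN {L : Type} [Field L] [Fintype L] (f : L → L) : Prop :=
  ∀ a b : L, a ≠ 0 → Set.ncard {x : L | f (x + a) + f x = b} ≤ 2

/-- The polynomial `(x+y)(x+z)(y+z)` in `L[x,y,z]` (variables `X 0, X 1, X 2`). -/
noncomputable def delta3 (L : Type) [CommRing L] : MvPolynomial (Fin 3) L :=
  (X 0 + X 1) * (X 0 + X 2) * (X 1 + X 2)

/-- The numerator `f(x) + f(y) + f(z) + f(x+y+z)` of `φ`, as an element of `L[x,y,z]`. -/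
noncomputable def phiNum {L : Type} [CommRing L] (f : Polynomial L) :
    MvPolynomial (Fin 3) L :=
  Polynomial.aeval (X 0 : MvPolynomial (Fin 3) L) f +
    Polynomial.aeval (X 1 : MvPolynomial (Fin 3) L) f +
    Polynomial.aeval (X 2 : MvPolynomial (Fin 3) L) f +
    Polynomial.aeval (X 0 + X 1 + X 2 : MvPolynomial (Fin 3) L) f

/-- The numerator `x^j + y^j + z^j + (x+y+z)^j` of `φ_j`, as an element of `L[x,y,z]`. -/
noncomputable def phiJNum (L : Type) [CommRing L] (j : ℕ) : MvPolynomial (Fin 3) L :=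
  X 0 ^ j + X 1 ^ j + X 2 ^ j + (X 0 + X 1 + X 2) ^ j

/-- A polynomial over a field `L` is absolutely irreducible if it is irreducible over
the algebraic closure of `L`. -/
def AbsolutelyIrreducible {L : Type} [Field L] (p : MvPolynomial (Fin 3) L) : Prop :=
  Irreducible (MvPolynomial.map (algebraMap L (AlgebraicClosure L)) p)

/-- `f ∈ L[x]` is exceptional APN if the induced function is APN on `L = F_q` and on
infinitely many extensions `F_{q^m}` of `L`. -/
def IsExceptionalAPN {L : Type} [Field L] [Fintype L] (f : Polynomial L) : Prop :=
  IsAPN (fun x => Polynomial.eval x f) ∧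
    {m : ℕ | ∀ (M : Type) [Field M] [Fintype M], ∀ e : L →+* M,
      Fintype.card M = Fintype.card L ^ m →
        IsAPN (fun x => Polynomial.eval x (f.map e))}.Infinite

namespace Polynomial

open scoped Polynomial

section Curve

open AdjoinRoot

section Filtration

variable {K : Type*} [Field K] {F : K[X][X]} (hF : F.Monic)

/-- The elements of `K[x][Y] / (F)` whose coordinates in the basis `1, Y, …` have degree at
most `n` in `x`. -/
noncomputable def coordDegreeLE (n : ℕ) : Submodule K (AdjoinRoot F) where
  carrier := {z | ∀ i, ((AdjoinRoot.modByMonicHom hF z).coeff i).natDegree ≤ n}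
  add_mem' {a b} ha hb i := by
    rw [map_add, coeff_add]
    exact (natDegree_add_le _ _).trans (max_le (ha i) (hb i))
  zero_mem' i := by simp
  smul_mem' c z hz i := by
    rw [← algebraMap_smul K[X] c z, map_smul, coeff_smul, smul_eq_mul, Polynomial.algebraMap_apply,
      Algebra.algebraMap_self_apply]
    exact (natDegree_C_mul_le _ _).trans (hz i)

lemma coordDegreeLE_mono {m n : ℕ} (h : m ≤ n) : coordDegreeLE hF m ≤ coordDegreeLE hF n :=
  fun _ hz i ↦ (hz i).trans h

lemma one_mem_coordDegreeLE : (1 : AdjoinRoot F) ∈ coordDegreeLE hF 0 := by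
  intro i
  rw [← map_one (mk F), AdjoinRoot.modByMonicHom_mk]
  by_cases h : F = 1
  · simp [h]
  · rw [(modByMonic_eq_self_iff hF).2, coeff_one]
    · split_ifs <;> simp
    · rw [degree_one]
      refine hF.degree_pos.2 h

lemma of_mul_mem_coordDegreeLE {n m : ℕ} {z : AdjoinRoot F} (hz : z ∈ coordDegreeLE hF n)
    {p : K[X]} (hp : p.natDegree ≤ m) : of F p * z ∈ coordDegreeLE hF (m + n) := by
  intro i
  rw [← AdjoinRoot.algebraMap_eq, ← Algebra.smul_def, map_smul, coeff_smul, smul_eq_mul]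
  exact natDegree_mul_le.trans (add_le_add hp (hz i))

lemma modByMonicHom_root_mul (hF1 : F ≠ 1) (z : AdjoinRoot F) :
    AdjoinRoot.modByMonicHom hF (root F * z) = X * AdjoinRoot.modByMonicHom hF z -
      C ((AdjoinRoot.modByMonicHom hF z).coeff (F.natDegree - 1)) * F := by
  set s := AdjoinRoot.modByMonicHom hF z with hs
  have hz : z = mk F s := (mk_leftInverse hF z).symm
  have hlt : s.degree < F.degree := by
    obtain ⟨p, rfl⟩ := mk_surjective z
    rw [hs, AdjoinRoot.modByMonicHom_mk]
    exact degree_modByMonic_lt _ hF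
  have hpos : 0 < F.natDegree := natDegree_pos_iff_degree_pos.2 (hF.degree_pos.2 hF1)
  have hslt : s.natDegree < F.natDegree := by
    by_cases h0 : s = 0
    · simpa [h0] using hpos
    · exact natDegree_lt_natDegree h0 hlt
  rw [hz, ← mk_X, ← map_mul, AdjoinRoot.modByMonicHom_mk]
  have h1 : X * s = (X * s - C (s.coeff (F.natDegree - 1)) * F) +
      F * C (s.coeff (F.natDegree - 1)) := by ring
  conv_lhs => rw [h1]
  rw [add_modByMonic, (modByMonic_eq_zero_iff_dvd hF).2 (dvd_mul_right _ _), add_zero,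
    (modByMonic_eq_self_iff hF).2]
  rw [degree_eq_natDegree hF.ne_zero, degree_lt_iff_coeff_zero]
  intro m hm
  obtain ⟨m, rfl⟩ : ∃ k, m = k + 1 := ⟨m - 1, by omega⟩
  rw [coeff_sub, coeff_X_mul, coeff_C_mul]
  rcases hm.lt_or_eq with h | h
  · rw [coeff_eq_zero_of_natDegree_lt (by omega), coeff_eq_zero_of_natDegree_lt h]
    simp
  · rw [← h, hF.coeff_natDegree, mul_one, h, Nat.add_sub_cancel, sub_self]

variable {e : ℕ} (he : ∀ i, (F.coeff i).natDegree ≤ e)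
include he

lemma root_mul_mem_coordDegreeLE {n : ℕ} {z : AdjoinRoot F} (hz : z ∈ coordDegreeLE hF n) :
    root F * z ∈ coordDegreeLE hF (n + e) := by
  intro i
  by_cases hF1 : F = 1
  · subst hF1
    obtain ⟨p, hp⟩ := mk_surjective (root (1 : K[X][X]) * z)
    rw [← hp, AdjoinRoot.modByMonicHom_mk]
    simp
  rw [modByMonicHom_root_mul hF hF1]
  rw [coeff_sub, coeff_C_mul]
  refine (natDegree_sub_le _ _).trans (max_le ?_ ?_)
  · cases i with
    | zero => simp
    | succ i => rw [coeff_X_mul]; exact (hz i).trans (by omega)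
  · exact natDegree_mul_le.trans (add_le_add (hz _) (he _))

lemma root_pow_mul_mem_coordDegreeLE {n : ℕ} {z : AdjoinRoot F} (hz : z ∈ coordDegreeLE hF n)
    (j : ℕ) : root F ^ j * z ∈ coordDegreeLE hF (n + e * j) := by
  induction j with
  | zero => simpa using hz
  | succ j ih =>
    rw [pow_succ', mul_assoc, mul_add, ← add_assoc, mul_one]
    exact root_mul_mem_coordDegreeLE hF he ih

lemma of_mul_root_pow_mem_coordDegreeLE {m : ℕ} {p : K[X]} (hp : p.natDegree ≤ m) (j : ℕ) :
    of F p * root F ^ j ∈ coordDegreeLE hF (m + e * j) := by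
  have := of_mul_mem_coordDegreeLE hF
    (root_pow_mul_mem_coordDegreeLE hF he (one_mem_coordDegreeLE hF) j) hp
  rwa [mul_one, zero_add] at this

lemma mk_mem_coordDegreeLE {m : ℕ} {p : K[X][X]} (hp : ∀ i, (p.coeff i).natDegree ≤ m) :
    mk F p ∈ coordDegreeLE hF (m + e * p.natDegree) := by
  rw [← aeval_eq, aeval_eq_sum_range]
  refine Submodule.sum_mem _ fun i hi ↦ ?_
  rw [Algebra.smul_def, AdjoinRoot.algebraMap_eq]
  refine coordDegreeLE_mono hF ?_ (of_mul_root_pow_mem_coordDegreeLE hF he (hp i) i)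
  have := Finset.mem_range_succ_iff.1 hi
  gcongr

lemma natDegree_norm_le {n : ℕ} {z : AdjoinRoot F} (hz : z ∈ coordDegreeLE hF n) :
    (Algebra.norm K[X] z).natDegree ≤ F.natDegree * (n + e * F.natDegree) := by
  classical
  rw [Algebra.norm_eq_matrix_det (powerBasisAux' hF), Matrix.det_apply]
  refine natDegree_sum_le_of_forall_le _ _ fun σ _ ↦ ?_
  refine (natDegree_smul_le _ _).trans ((natDegree_prod_le _ _).trans ?_)
  refine (Finset.sum_le_card_nsmul _ _ (n + e * F.natDegree) fun i _ ↦ ?_).trans (by simp)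
  rw [Algebra.leftMulMatrix_eq_repr_mul, powerBasisAux'_repr_apply_to_fun]
  have hb : powerBasisAux' hF i = root F ^ (i : ℕ) := (powerBasis' hF).basis_eq_pow i
  rw [hb, mul_comm]
  refine (root_pow_mul_mem_coordDegreeLE hF he hz i _).trans ?_
  have := i.2.le
  gcongr

end Filtration

section Quotient

variable {K : Type*} [Field K] {F : K[X][X]} (hF : F.Monic) [IsDomain (AdjoinRoot F)]

include hF in
lemma finiteDimensional_adjoinRoot_quotient {I : Ideal (AdjoinRoot F)} (hI : I ≠ ⊥) :
    FiniteDimensional K (AdjoinRoot F ⧸ I) := by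
  let b := powerBasisAux' hF
  exact Module.Finite.equiv (I.quotientEquivDirectSum K b hI).symm

include hF in
lemma finrank_quotient_span_le {e : ℕ} (he : ∀ i, (F.coeff i).natDegree ≤ e) {n : ℕ}
    {z : AdjoinRoot F} (hz : z ∈ coordDegreeLE hF n) (hz0 : z ≠ 0) :
    Module.finrank K (AdjoinRoot F ⧸ Ideal.span {z}) ≤ F.natDegree * (n + e * F.natDegree) := by
  rw [finrank_quotient_span_eq_natDegree_norm (powerBasisAux' hF) hz0]
  exact natDegree_norm_le hF he hz

/-- Evaluation of elements of `K[x][Y] / (F)` at a point of the curve `F = 0`. -/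
noncomputable def curveEval {x y : K} (h : F.evalEval x y = 0) : AdjoinRoot F →ₐ[K] K :=
  liftAlgHom F (aeval x) y (by
    rw [← h, ← eval₂_evalRingHom]
    rfl)

omit [IsDomain (AdjoinRoot F)] in
@[simp] lemma curveEval_of {x y : K} (h : F.evalEval x y = 0) (p : K[X]) :
    curveEval h (of F p) = p.eval x := by
  simp [curveEval, aeval_def, eval₂_eq_eval_map]

omit [IsDomain (AdjoinRoot F)] in
@[simp] lemma curveEval_root {x y : K} (h : F.evalEval x y = 0) :
    curveEval h (root F) = y := by
  simp [curveEval]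

omit [IsDomain (AdjoinRoot F)] in
lemma curveEval_mk {x y : K} (h : F.evalEval x y = 0) (p : K[X][X]) :
    curveEval h (mk F p) = p.evalEval x y := by
  rw [curveEval, liftAlgHom_mk, ← eval₂_evalRingHom]
  rfl

include hF in
/-- A nonzero function on a plane curve has few zeros. -/
lemma card_zeros_le {e : ℕ} (he : ∀ i, (F.coeff i).natDegree ≤ e) {n : ℕ}
    {z : AdjoinRoot F} (hz : z ∈ coordDegreeLE hF n) (hz0 : z ≠ 0) (T : Finset (K × K))
    (hT : ∀ P ∈ T, ∃ h : F.evalEval P.1 P.2 = 0, curveEval h z = 0) :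
    T.card ≤ F.natDegree * (n + e * F.natDegree) := by
  refine le_trans ?_ (finrank_quotient_span_le hF he hz hz0)
  have hspan : Ideal.span {z} ≠ ⊥ := by simpa using hz0
  have := finiteDimensional_adjoinRoot_quotient hF hspan
  choose h hh using hT
  let φ : T → (AdjoinRoot F ⧸ Ideal.span {z} →ₐ[K] K) := fun P ↦
    Ideal.Quotient.liftₐ (Ideal.span {z}) (curveEval (h P P.2)) (by
      intro a ha
      obtain ⟨c, rfl⟩ := Ideal.mem_span_singleton'.1 ha
      rw [map_mul, hh P.1 P.2, mul_zero])
  have hφ (P : T) (a : AdjoinRoot F) : φ P (Ideal.Quotient.mk _ a) = curveEval (h P P.2) a := rfl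
  have hinj : Function.Injective φ := by
    intro P P' hPP
    have h1 := hφ P (of F X)
    have h2 := hφ P (root F)
    rw [hPP, hφ, curveEval_of, curveEval_of, eval_X, eval_X] at h1
    rw [hPP, hφ, curveEval_root, curveEval_root] at h2
    exact Subtype.ext (Prod.ext h1.symm h2.symm)
  have hli := (linearIndependent_algHom_toLinearMap K
    (AdjoinRoot F ⧸ Ideal.span {z}) K).comp φ hinj
  have := hli.fintype_card_le_finrank
  rwa [Fintype.card_coe, Subspace.dual_finrank_eq] at this

include hF in
lemma le_of_mem_ker_pow {e : ℕ} (he : ∀ i, (F.coeff i).natDegree ≤ e) {n : ℕ}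
    {z : AdjoinRoot F} (hz : z ∈ coordDegreeLE hF n) (hz0 : z ≠ 0) (P : Ideal (AdjoinRoot F))
    (hP : P ≠ ⊤) {q : ℕ} (hzP : z ∈ P ^ q) :
    q ≤ F.natDegree * (n + e * F.natDegree) := by
  refine le_trans ?_ (finrank_quotient_span_le hF he hz hz0)
  have hspan : Ideal.span {z} ≠ ⊥ := by simpa using hz0
  have := finiteDimensional_adjoinRoot_quotient hF hspan
  let V (i : ℕ) : Submodule K (AdjoinRoot F ⧸ Ideal.span {z}) :=
    ((P ^ i).restrictScalars K).map (Ideal.Quotient.mkₐ K (Ideal.span {z})).toLinearMap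
  have hlt (i : ℕ) (hi : i < q) : V (i + 1) < V i := by
    have hle : P ^ (i + 1) ≤ P ^ i := Ideal.pow_le_pow_right i.le_succ
    refine lt_of_le_of_ne (Submodule.map_mono hle) fun heq ↦ ?_
    have hPeq : P ^ i ≤ P ^ (i + 1) := by
      intro a ha
      have h1 : (Ideal.Quotient.mkₐ K (Ideal.span {z})).toLinearMap a ∈ V (i + 1) := by
        rw [heq]
        exact Submodule.mem_map_of_mem ha
      obtain ⟨b, hb, hab⟩ := h1
      have h2 : a - b ∈ Ideal.span {z} := by
        rw [← Ideal.Quotient.eq]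
        exact hab.symm
      have h3 : a - b ∈ P ^ (i + 1) :=
        Ideal.pow_le_pow_right hi ((Ideal.span_singleton_le_iff_mem _).2 hzP h2)
      have := add_mem h3 hb
      rwa [sub_add_cancel] at this
    have heq' : P ^ (i + 1) = P ^ i := le_antisymm hle hPeq
    have hstab (k : ℕ) : P ^ (i + k) = P ^ i := by
      induction k with
      | zero => rfl
      | succ k ih => rw [← add_assoc, pow_succ, ih, ← pow_succ, heq']
    have hzne : P ^ i ≠ ⊥ := by
      intro hbot
      have h4 := Ideal.pow_le_pow_right hi.le hzP
      rw [hbot] at h4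
      exact hz0 h4
    have hidem : IsIdempotentElem (P ^ i) := by
      rw [IsIdempotentElem, ← pow_add, hstab]
    rcases (Ideal.isIdempotentElem_iff_eq_bot_or_top _
      (IsNoetherian.noetherian _)).1 hidem with h5 | h5
    · exact hzne h5
    · refine hP (top_le_iff.1 ?_)
      rw [← h5, ← heq']
      exact Ideal.pow_le_self i.succ_ne_zero
  have hfin (i : ℕ) (hi : i ≤ q) : i + Module.finrank K (V i) ≤
      Module.finrank K (AdjoinRoot F ⧸ Ideal.span {z}) := by
    induction i with
    | zero => simpa using Submodule.finrank_le _
    | succ i ih =>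
      have h1 := ih (by omega)
      have h2 := Submodule.finrank_lt_finrank_of_lt (hlt i hi)
      omega
  exact (Nat.le_add_right _ _).trans (hfin q le_rfl)

end Quotient

section Nonvanishing

variable {K : Type*} [Field K] {F : K[X][X]} (hF : F.Monic)

lemma exists_mem_coordDegreeLE (z : AdjoinRoot F) : ∃ n, z ∈ coordDegreeLE hF n := by
  refine ⟨(AdjoinRoot.modByMonicHom hF z).support.sup
    fun i ↦ ((AdjoinRoot.modByMonicHom hF z).coeff i).natDegree, fun i ↦ ?_⟩
  by_cases hi : (AdjoinRoot.modByMonicHom hF z).coeff i = 0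
  · simp [hi]
  · exact Finset.le_sup
      (f := fun i ↦ ((AdjoinRoot.modByMonicHom hF z).coeff i).natDegree) (mem_support_iff.2 hi)

include hF in
lemma sum_smul_monomials_eq_zero {m : ℕ} (c : Fin m × Fin F.natDegree → K)
    (h : ∑ w, c w • (of F (X ^ (w.1 : ℕ)) * root F ^ (w.2 : ℕ)) = 0) : c = 0 := by
  have hli := Fintype.linearIndependent_iff.1 (powerBasisAux' hF).linearIndependent
    (fun j ↦ ∑ i, c (i, j) • X ^ (i : ℕ)) (by
      rw [← h, Fintype.sum_prod_type_right]
      refine Finset.sum_congr rfl fun j _ ↦ ?_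
      have hb : powerBasisAux' hF j = root F ^ (j : ℕ) := (powerBasis' hF).basis_eq_pow j
      rw [hb, Finset.sum_smul]
      refine Finset.sum_congr rfl fun i _ ↦ ?_
      rw [smul_assoc, Algebra.smul_def (X ^ (i : ℕ)), AdjoinRoot.algebraMap_eq])
  ext ⟨i, j⟩
  have := congr_arg (fun p ↦ p.coeff i) (hli j)
  simpa [finsetSum_coeff, coeff_X_pow, Fin.val_inj] using this

include hF in
lemma exists_evalEval_eq_zero [IsAlgClosed K] (h1 : F ≠ 1) (x : K) :
    ∃ y, F.evalEval x y = 0 := by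
  have hm : (F.map (evalRingHom x)).Monic := hF.map _
  obtain ⟨y, hy⟩ := IsAlgClosed.exists_root (F.map (evalRingHom x)) (by
    rw [hF.degree_map]
    exact (hF.degree_pos.2 h1).ne')
  exact ⟨y, by rwa [IsRoot, map_evalRingHom_eval] at hy⟩

include hF in
lemma exists_curveEval_ne_zero [IsAlgClosed K] [IsDomain (AdjoinRoot F)] (h1 : F ≠ 1)
    {z : AdjoinRoot F} (hz : z ≠ 0) :
    ∃ (x y : K) (h : F.evalEval x y = 0), curveEval h z ≠ 0 := by
  classical
  by_contra! hcon
  obtain ⟨n, hn⟩ := exists_mem_coordDegreeLE hF z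
  obtain ⟨e, he⟩ : ∃ e, ∀ i, (F.coeff i).natDegree ≤ e := by
    refine ⟨F.support.sup fun i ↦ (F.coeff i).natDegree, fun i ↦ ?_⟩
    by_cases hi : F.coeff i = 0
    · simp [hi]
    · exact Finset.le_sup (f := fun i ↦ (F.coeff i).natDegree) (mem_support_iff.2 hi)
  have : Infinite K := IsAlgClosed.instInfinite
  obtain ⟨S, hS⟩ := Infinite.exists_subset_card_eq K (F.natDegree * (n + e * F.natDegree) + 1)
  choose y hy using exists_evalEval_eq_zero hF h1
  have := card_zeros_le hF he hn hz (S.image fun x ↦ (x, y x)) (by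
    intro P hP
    obtain ⟨x, -, rfl⟩ := Finset.mem_image.1 hP
    exact ⟨hy x, hcon _ _ _⟩)
  rw [Finset.card_image_of_injective _ fun a b hab ↦ (Prod.mk.inj hab).1] at this
  omega

lemma monomial_mem_coordDegreeLE {e : ℕ} (he : ∀ i, (F.coeff i).natDegree ≤ e) {i j l d : ℕ}
    (hi : i ≤ l) (hj : j ≤ d) : of F (X ^ i) * root F ^ j ∈ coordDegreeLE hF (l + e * d) := by
  refine coordDegreeLE_mono hF ?_ (of_mul_root_pow_mem_coordDegreeLE hF he
    (natDegree_X_pow_le (R := K) i) j)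
  gcongr

include hF in
lemma sum_monomial_mul_pow_ne_zero [IsAlgClosed K] [CharP K 2] [IsDomain (AdjoinRoot F)]
    (h1 : F ≠ 1) {e : ℕ} (he : ∀ i, (F.coeff i).natDegree ≤ e) {l κ : ℕ}
    (hκ : F.natDegree * (l + e * F.natDegree + e * F.natDegree) < 2 ^ κ)
    (z : Fin l × Fin F.natDegree → AdjoinRoot F) (hz : z ≠ 0) :
    ∑ w, (of F (X ^ (w.1 : ℕ)) * root F ^ (w.2 : ℕ)) * z w ^ (2 ^ κ) ≠ 0 := by
  intro hsum
  obtain ⟨w₀, hw₀⟩ := Function.ne_iff.1 hz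
  obtain ⟨x, y, h, hev⟩ := exists_curveEval_ne_zero hF h1 hw₀
  have : CharP (AdjoinRoot F) 2 := charP_of_injective_algebraMap (algebraMap K _).injective 2
  set P : Ideal (AdjoinRoot F) := RingHom.ker (curveEval h) with hP
  have hPtop : P ≠ ⊤ := RingHom.ker_ne_top _
  set c : Fin l × Fin F.natDegree → K := fun w ↦ curveEval h (z w) ^ 2 ^ κ with hc
  set v : AdjoinRoot F := ∑ w, c w • (of F (X ^ (w.1 : ℕ)) * root F ^ (w.2 : ℕ)) with hv
  have hv0 : v ≠ 0 := by
    intro h0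
    have := congr_fun (sum_smul_monomials_eq_zero hF c h0) w₀
    exact hev (by simpa [hc] using this)
  have hvmem : v ∈ coordDegreeLE hF (l + e * F.natDegree) :=
    Submodule.sum_mem _ fun w _ ↦ Submodule.smul_mem _ _
      (monomial_mem_coordDegreeLE hF he w.1.2.le w.2.2.le)
  have hvP : v ∈ P ^ 2 ^ κ := by
    rw [← sub_zero v, ← hsum, hv, ← Finset.sum_sub_distrib]
    refine Ideal.sum_mem _ fun w _ ↦ ?_
    have hcw : c w = curveEval h (z w) ^ 2 ^ κ := rfl
    rw [Algebra.smul_def, mul_comm, ← mul_sub, hcw, map_pow (algebraMap K (AdjoinRoot F)),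
      ← sub_pow_char_pow]
    refine Ideal.mul_mem_left _ _ (Ideal.pow_mem_pow ?_ _)
    rw [hP, RingHom.mem_ker, map_sub, AlgHom.commutes]
    simp
  exact hκ.not_ge (le_of_mem_ker_pow hF he hvmem hv0 P hPtop hvP)

end Nonvanishing

section Auxiliary

lemma sub_mul_sum_eq_of_recurrence {K : Type*} [CommRing K] (D : ℕ) (α f : ℕ → K) (y t : K)
    (h : ∀ j < D, α j = y * α (j + 1) + f (j + 1) * α D) :
    (t - y) * ∑ j ∈ Finset.range (D + 1), α j * t ^ j =
      α D * (∑ j ∈ Finset.range (D + 1), f j * t ^ j + t ^ (D + 1)) - (α D * f 0 + y * α 0) := by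
  have h1 : ∑ j ∈ Finset.range D, α j * t ^ (j + 1) =
      ∑ j ∈ Finset.range D, (y * (α (j + 1) * t ^ (j + 1)) +
        α D * (f (j + 1) * t ^ (j + 1))) := by
    refine Finset.sum_congr rfl fun j hj ↦ ?_
    rw [h j (Finset.mem_range.1 hj)]
    ring
  rw [Finset.sum_add_distrib, ← Finset.mul_sum, ← Finset.mul_sum] at h1
  have h2 : t * ∑ j ∈ Finset.range (D + 1), α j * t ^ j =
      ∑ j ∈ Finset.range D, α j * t ^ (j + 1) + α D * t ^ (D + 1) := by
    rw [Finset.mul_sum, Finset.sum_range_succ]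
    congr 1
    · exact Finset.sum_congr rfl fun j _ ↦ by ring
    · ring
  rw [sub_mul, h2, h1, Finset.sum_range_succ' (fun j ↦ α j * t ^ j),
    Finset.sum_range_succ' (fun j ↦ f j * t ^ j)]
  ring

variable {K : Type*} [Field K] {F : K[X][X]} (hF : F.Monic)

include hF in
lemma evalEval_eq_sum {D : ℕ} (hD : F.natDegree = D + 1) (x t : K) :
    F.evalEval x t =
      ∑ j ∈ Finset.range (D + 1), (F.coeff j).eval x * t ^ j + t ^ (D + 1) := by
  have h1 := hF.as_sum
  rw [hD] at h1
  conv_lhs => rw [h1]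
  simp only [evalEval, eval_add, eval_pow, eval_X, eval_C, eval_finsetSum, eval_mul]
  ring

lemma evalEval_pow_eq [CharP K 2] {N : ℕ}
    (hFr : ∀ i j, ((F.coeff i).coeff j) ^ 2 ^ N = (F.coeff i).coeff j) (x y : K) :
    F.evalEval x y ^ 2 ^ N = F.evalEval (x ^ 2 ^ N) (y ^ 2 ^ N) := by
  have h : F.map (mapRingHom (iterateFrobenius K 2 N)) = F := by
    ext i j
    simp [iterateFrobenius_def, hFr]
  rw [← iterateFrobenius_def, ← map_mapRingHom_evalEval, h]
  rfl

end Auxiliary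

section AuxiliaryFunction

variable {K : Type*} [Field K] {F : K[X][X]} (hF : F.Monic)

lemma eq_zero_of_coord_eq_zero {n : ℕ} {z : AdjoinRoot F} (hz : z ∈ coordDegreeLE hF n)
    (h : ∀ (i : Fin F.natDegree) (a : Fin (n + 1)),
      ((AdjoinRoot.modByMonicHom hF z).coeff i).coeff a = 0) : z = 0 := by
  have h0 : AdjoinRoot.modByMonicHom hF z = 0 := by
    ext i a
    rw [coeff_zero, coeff_zero]
    by_cases hi : i < F.natDegree
    · by_cases ha : a < n + 1
      · exact h ⟨i, hi⟩ ⟨a, ha⟩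
      · exact coeff_eq_zero_of_natDegree_lt ((hz i).trans_lt (by omega))
    · obtain ⟨p, rfl⟩ := mk_surjective z
      rw [AdjoinRoot.modByMonicHom_mk, coeff_eq_zero_of_degree_lt (p := p %ₘ F), coeff_zero]
      refine (degree_modByMonic_lt _ hF).trans_le ?_
      rw [degree_eq_natDegree hF.ne_zero]
      exact_mod_cast not_lt.1 hi
  rw [← mk_leftInverse hF z, h0, map_zero]

lemma exists_ne_zero_forall_eq_zero {V ι : Type*} [AddCommGroup V] [Module K V]
    [FiniteDimensional K V] [Fintype ι] {n : ℕ} (L : ι → V →ₗ[K] AdjoinRoot F)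
    (hL : ∀ i v, L i v ∈ coordDegreeLE hF n)
    (hcard : Fintype.card ι * (F.natDegree * (n + 1)) < Module.finrank K V) :
    ∃ v ≠ 0, ∀ i, L i v = 0 := by
  let Φ : V →ₗ[K] (ι × Fin F.natDegree × Fin (n + 1) → K) := LinearMap.pi fun w ↦
    lcoeff K w.2.2 ∘ₗ (lcoeff K[X] w.2.1).restrictScalars K ∘ₗ
      (AdjoinRoot.modByMonicHom hF).restrictScalars K ∘ₗ L w.1
  have hker : LinearMap.ker Φ ≠ ⊥ := LinearMap.ker_ne_bot_of_finrank_lt (by simpa using hcard)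
  obtain ⟨v, hv, hv0⟩ := Submodule.exists_mem_ne_zero_of_ne_bot hker
  refine ⟨v, hv0, fun i ↦ eq_zero_of_coord_eq_zero hF (hL i v) fun a b ↦ ?_⟩
  exact congr_fun (LinearMap.mem_ker.1 hv) (i, a, b)

include hF in
/-- The auxiliary function of Stepanov's method for the curve `F = 0`. -/
lemma exists_auxiliary_function [IsAlgClosed K] [CharP K 2] [IsDomain (AdjoinRoot F)] {D e : ℕ}
    (hD : F.natDegree = D + 1) (he : ∀ i, (F.coeff i).natDegree ≤ e) {l m ρ κ : ℕ}
    (hκ : F.natDegree * (l + e * F.natDegree + e * F.natDegree) < 2 ^ κ)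
    (hcount : D * (F.natDegree * (2 ^ ρ * l + m + e * (2 ^ ρ * F.natDegree) + e + 1)) <
      (l * F.natDegree) * (m * F.natDegree))
    (hFr : ∀ i j, ((F.coeff i).coeff j) ^ 2 ^ (κ + ρ) = (F.coeff i).coeff j) :
    ∃ G : AdjoinRoot F, G ≠ 0 ∧
      G ∈ coordDegreeLE hF (l + m * 2 ^ κ + e * (F.natDegree + F.natDegree * 2 ^ κ)) ∧
      ∀ (x y : K) (h : F.evalEval x y = 0), x ^ 2 ^ (κ + ρ) = x → y ^ 2 ^ (κ + ρ) ≠ y →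
        curveEval h G = 0 := by
  classical
  have h1 : F ≠ 1 := by
    rintro rfl
    simp at hD
  have : CharP (AdjoinRoot F) 2 := charP_of_injective_algebraMap (algebraMap K _).injective 2
  let mon (w : Fin l × Fin F.natDegree) (i : Fin m) : AdjoinRoot F :=
    of F (X ^ (2 ^ ρ * w.1 + i : ℕ)) * root F ^ (2 ^ ρ * w.2 : ℕ)
  let A (j : ℕ) : ((Fin l × Fin F.natDegree) × (Fin m × Fin F.natDegree) → K) →ₗ[K]
      AdjoinRoot F :=
    ∑ w, ∑ u : Fin m × Fin F.natDegree, if (u.2 : ℕ) = j then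
      (LinearMap.toSpanSingleton K (AdjoinRoot F) (mon w u.1)) ∘ₗ LinearMap.proj (w, u) else 0
  have hA (j : ℕ) (C) : A j C = ∑ w, ∑ u : Fin m × Fin F.natDegree,
      if (u.2 : ℕ) = j then C (w, u) • mon w u.1 else 0 := by
    simp only [A, LinearMap.sum_apply]
    refine Finset.sum_congr rfl fun w _ ↦ Finset.sum_congr rfl fun u _ ↦ ?_
    split_ifs <;> simp
  set n₀ := 2 ^ ρ * l + m + e * (2 ^ ρ * F.natDegree) with hn₀
  have hAmem (j : ℕ) (C) : A j C ∈ coordDegreeLE hF n₀ := by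
    rw [hA]
    refine Submodule.sum_mem _ fun w _ ↦ Submodule.sum_mem _ fun u _ ↦ ?_
    split_ifs
    · refine Submodule.smul_mem _ _ (monomial_mem_coordDegreeLE hF he ?_ ?_)
      · have := w.1.2.le
        have := u.1.2.le
        gcongr
      · have := w.2.2.le
        gcongr
    · exact zero_mem _
  let L (j : Fin D) := A j - LinearMap.mulLeft K (root F) ∘ₗ A (j + 1) -
    LinearMap.mulLeft K (of F (F.coeff (j + 1))) ∘ₗ A D
  obtain ⟨C, hC0, hC⟩ := exists_ne_zero_forall_eq_zero hF (n := n₀ + e) L (by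
    intro j C
    refine sub_mem (sub_mem ?_ ?_) ?_
    · exact coordDegreeLE_mono hF (by omega) (hAmem j C)
    · exact root_mul_mem_coordDegreeLE hF he (hAmem _ C)
    · rw [add_comm]
      exact of_mul_mem_coordDegreeLE hF (hAmem _ C) (he _)) (by simpa using hcount)
  have hrec (j : ℕ) (hj : j < D) :
      A j C = root F * A (j + 1) C + of F (F.coeff (j + 1)) * A D C := by
    have := hC ⟨j, hj⟩
    simp only [L, LinearMap.sub_apply, LinearMap.comp_apply, LinearMap.mulLeft_apply] at this
    linear_combination this
  have hroot (a : K) : ∃ c, c ^ 2 ^ (κ + ρ) = a := IsAlgClosed.exists_pow_nat_eq a (by positivity)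
  choose s hs using hroot
  let z (w : Fin l × Fin F.natDegree) : AdjoinRoot F :=
    ∑ u : Fin m × Fin F.natDegree, s (C (w, u)) • (of F (X ^ (u.1 : ℕ)) * root F ^ (u.2 : ℕ))
  have hz : z ≠ 0 := by
    intro hz
    refine hC0 ?_
    ext ⟨w, u⟩
    have := congr_fun (sum_smul_monomials_eq_zero hF _ (congr_fun hz w)) u
    rw [← hs (C (w, u)), show s (C (w, u)) = 0 from this, zero_pow (by positivity)]
    rfl
  refine ⟨_, sum_monomial_mul_pow_ne_zero hF h1 he hκ z hz, ?_, ?_⟩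
  · refine Submodule.sum_mem _ fun w _ ↦ ?_
    simp only [z]
    rw [sum_pow_char_pow, Finset.mul_sum]
    refine Submodule.sum_mem _ fun u _ ↦ ?_
    rw [Algebra.smul_def, mul_pow, ← map_pow, mul_left_comm, ← Algebra.smul_def]
    refine Submodule.smul_mem _ _ ?_
    rw [show (of F (X ^ (w.1 : ℕ)) * root F ^ (w.2 : ℕ)) *
      (of F (X ^ (u.1 : ℕ)) * root F ^ (u.2 : ℕ)) ^ 2 ^ κ =
      of F (X ^ (w.1 + u.1 * 2 ^ κ : ℕ)) * root F ^ (w.2 + u.2 * 2 ^ κ : ℕ) by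
        simp only [map_pow]; ring]
    have h1 := w.1.2.le
    have h2 := w.2.2.le
    have h3 := u.1.2.le
    have h4 := u.2.2.le
    refine monomial_mem_coordDegreeLE hF he ?_ ?_ <;> gcongr
  · intro x y h hx hy
    have hF' := evalEval_pow_eq hFr x y
    rw [h, hx, zero_pow (by positivity)] at hF'
    rw [evalEval_eq_sum hF hD] at hF'
    have h0 := h
    rw [evalEval_eq_sum hF hD] at h0
    have hrec' (j : ℕ) (hj : j < D) : curveEval h (A j C) =
        y * curveEval h (A (j + 1) C) + (F.coeff (j + 1)).eval x * curveEval h (A D C) := by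
      rw [hrec j hj]
      simp
    have key (t : K) := sub_mul_sum_eq_of_recurrence D (fun j ↦ curveEval h (A j C))
      (fun j ↦ (F.coeff j).eval x) y t hrec'
    have k1 := key y
    have k2 := key (y ^ 2 ^ (κ + ρ))
    rw [h0, sub_self, zero_mul] at k1
    have hS : (y ^ 2 ^ (κ + ρ) - y) * ∑ j ∈ Finset.range (D + 1),
        curveEval h (A j C) * (y ^ 2 ^ (κ + ρ)) ^ j = 0 := by
      rw [k2, ← hF']
      linear_combination -k1
    have hS0 := (mul_eq_zero.1 hS).resolve_left (sub_ne_zero.2 hy)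
    refine pow_eq_zero_iff (n := 2 ^ ρ) (by positivity) |>.1 (Eq.trans ?_ hS0)
    simp only [map_sum, map_mul, map_pow, map_smul, curveEval_of, curveEval_root, eval_X,
      sum_pow_char_pow, z, hA, mul_pow, smul_eq_mul, Finset.sum_mul]
    rw [Finset.sum_comm]
    refine Finset.sum_congr rfl fun w _ ↦ ?_
    rw [Finset.mul_sum, Finset.sum_comm]
    refine Finset.sum_congr rfl fun u _ ↦ ?_
    have hu : (u.2 : ℕ) ∈ Finset.range (D + 1) := by
      rw [← hD]
      exact Finset.mem_range.2 u.2.2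
    rw [Finset.sum_eq_single_of_mem _ hu fun j _ hj ↦ by simp [hj.symm], if_pos rfl]
    have hpow (a : K) : (a ^ 2 ^ κ) ^ 2 ^ ρ = a ^ 2 ^ (κ + ρ) := by rw [← pow_mul, ← pow_add]
    rw [hpow, hpow, hpow, hs, pow_right_comm x _ (2 ^ (κ + ρ)), hx,
      pow_right_comm y _ (2 ^ (κ + ρ))]
    simp only [mon, map_smul, map_mul, map_pow, curveEval_of, curveEval_root, eval_X, smul_eq_mul]
    ring

end AuxiliaryFunction

section RationalPoints

variable {K : Type*} [Field K] {F : K[X][X]} (hF : F.Monic)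

include hF in
lemma card_roots_toFinset_of_derivative [IsAlgClosed K] [DecidableEq K] {x : K}
    (h : ∀ y, F.evalEval x y = 0 → F.derivative.evalEval x y ≠ 0) :
    (F.map (evalRingHom x)).roots.toFinset.card = F.natDegree := by
  have hm : (F.map (evalRingHom x)).Monic := hF.map _
  rw [Multiset.toFinset_card_of_nodup, ← (IsAlgClosed.splits _).natDegree_eq_card_roots,
    hF.natDegree_map]
  rw [Multiset.nodup_iff_count_le_one]
  intro y
  rw [count_roots]
  by_contra! hlt
  rw [one_lt_rootMultiplicity_iff_isRoot hm.ne_zero, IsRoot, IsRoot, derivative_map,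
    map_evalRingHom_eval, map_evalRingHom_eval] at hlt
  exact h y hlt.1 hlt.2

include hF in
lemma card_singular_fibres_le [IsDomain (AdjoinRoot F)] {e : ℕ}
    (he : ∀ i, (F.coeff i).natDegree ≤ e) (hder : F.derivative ≠ 0) (S : Finset K)
    (hS : ∀ x ∈ S, ∃ y, F.evalEval x y = 0 ∧ F.derivative.evalEval x y = 0) :
    S.card ≤ F.natDegree * (e + e * F.natDegree + e * F.natDegree) := by
  classical
  have hF0 : F.natDegree ≠ 0 := by
    intro h
    rw [hF.natDegree_eq_zero] at h
    simp [h] at hder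
  have hlt : F.derivative.natDegree < F.natDegree := natDegree_derivative_lt hF0
  have hmem : mk F F.derivative ∈ coordDegreeLE hF (e + e * F.natDegree) := by
    refine coordDegreeLE_mono hF ?_ (mk_mem_coordDegreeLE hF he (m := e) fun i ↦ ?_)
    · gcongr
    · rw [coeff_derivative]
      refine natDegree_mul_le.trans ?_
      have : ((i : K[X]) + 1).natDegree = 0 := by exact_mod_cast natDegree_natCast (i + 1)
      rw [this]
      exact he _
  have hne : mk F F.derivative ≠ 0 := by
    rw [Ne, mk_eq_zero]
    exact fun hdvd ↦ (natDegree_le_of_dvd hdvd hder).not_gt hlt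
  choose! y hy using hS
  have := card_zeros_le hF he hmem hne (S.image fun x ↦ (x, y x)) (by
    intro P hP
    obtain ⟨x, hx, rfl⟩ := Finset.mem_image.1 hP
    exact ⟨(hy x hx).1, by rw [curveEval_mk]; exact (hy x hx).2⟩)
  rwa [Finset.card_image_of_injective _ fun a b hab ↦ (Prod.mk.inj hab).1] at this

include hF in
lemma natDegree_mul_card_le [IsAlgClosed K] [DecidableEq K] [IsDomain (AdjoinRoot F)] {e : ℕ}
    (he : ∀ i, (F.coeff i).natDegree ≤ e) (hder : F.derivative ≠ 0) (S : Finset K) :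
    F.natDegree * S.card ≤
      ((S.sigma fun x ↦ (F.map (evalRingHom x)).roots.toFinset).image
        fun s ↦ (s.1, s.2)).card +
      F.natDegree * (F.natDegree * (e + e * F.natDegree + e * F.natDegree)) := by
  classical
  have hinj : Function.Injective (fun s : (_ : K) × K ↦ (s.1, s.2)) := by
    rintro ⟨a, b⟩ ⟨a', b'⟩ h
    simpa using h
  rw [Finset.card_image_of_injective _ hinj, Finset.card_sigma]
  set bad : K → Prop := fun x ↦ ∃ y, F.evalEval x y = 0 ∧ F.derivative.evalEval x y = 0
  have hbad := card_singular_fibres_le hF he hder (S.filter bad) fun x hx ↦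
    (Finset.mem_filter.1 hx).2
  have hsplit := Finset.card_filter_add_card_filter_not (s := S) bad
  have hgood : (S.filter fun x ↦ ¬ bad x).card * F.natDegree ≤
      ∑ x ∈ S, (F.map (evalRingHom x)).roots.toFinset.card := by
    rw [← smul_eq_mul, ← Finset.sum_const]
    refine le_trans (Finset.sum_le_sum fun x hx ↦ ?_)
      (Finset.sum_le_sum_of_subset (Finset.filter_subset (fun x ↦ ¬ bad x) S))
    refine (card_roots_toFinset_of_derivative hF fun y hy hy' ↦ ?_).ge
    exact (Finset.mem_filter.1 hx).2 ⟨y, hy, hy'⟩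
  rw [← hsplit, mul_add, add_comm, mul_comm]
  gcongr

lemma stepanov_count {d D e H H' r : ℕ} (hd : d = D + 1) (hH : H = H' + 1) (hH2 : 2 * d ≤ H)
    (hr : 1 ≤ r) :
    D * (d * (H * r * (2 * d * (e * d + e + 2)) + H' * r + e * (H * r * d) + e + 1)) <
      (2 * d * (e * d + e + 2)) * d * (H' * r * d) := by
  obtain ⟨w, rfl⟩ : ∃ w, H' = D + w := ⟨H' - D, by omega⟩
  have hw : H ≤ 2 * w := by omega
  set E := e * d + e + 2 with hE
  have hHr : 1 ≤ H * r := Nat.one_le_iff_ne_zero.2 (Nat.mul_ne_zero (by omega) (by omega))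
  have hle : D * ((D + w) * r + e * (H * r * d) + e + 1) ≤ D * (H * r * E) := by
    refine Nat.mul_le_mul_left D ?_
    have h1 : (D + w) * r ≤ H * r := Nat.mul_le_mul_right r (by omega)
    have h2 := Nat.mul_le_mul_right (e + 1) hHr
    have h3 : H * r * E = H * r + e * (H * r * d) + H * r * (e + 1) := by rw [hE]; ring
    omega
  have hlt : D * (H * r * E) < d * (H * r * E) := by
    refine Nat.mul_lt_mul_of_pos_right (by omega) (Nat.mul_pos hHr ?_)
    omega
  have hmain : d * (H * r * E) ≤ d * (2 * w * r * E) := by gcongr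
  have hsum : 2 * d * E * ((D + w) * r * d) =
      D * (H * r * (2 * d * E)) + d * (2 * w * r * E) := by
    rw [hH, hd]
    ring
  have hfin : D * (H * r * (2 * d * E) + (D + w) * r + e * (H * r * d) + e + 1) <
      2 * d * E * ((D + w) * r * d) := by
    rw [hsum]
    have : D * (H * r * (2 * d * E) + (D + w) * r + e * (H * r * d) + e + 1) =
      D * (H * r * (2 * d * E)) + D * ((D + w) * r + e * (H * r * d) + e + 1) := by ring
    omega
  have := Nat.mul_lt_mul_of_pos_right hfin (by omega : 0 < d)
  calc _ = D * (H * r * (2 * d * E) + (D + w) * r + e * (H * r * d) + e + 1) * d := by ring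
    _ < _ := this
    _ = _ := by ring

lemma stepanov_bound {d q r B δ l e H : ℕ} (hd : 0 < d) (hq : 1 ≤ q)
    (hr : e * d + B + 1 + δ + l + e * d + e * d ≤ r)
    (h : d * (q * ((H + 1) * r)) ≤
      B + d * (l + H * r * q + e * (d + d * q) + e * d) + d * δ) : False := by
  have h1 := Nat.mul_le_mul_left (d * q) hr
  have h2 := Nat.mul_le_mul_left (B + 1) (Nat.mul_le_mul hd hq)
  have h4 := Nat.mul_le_mul_left (d * (δ + l + e * d + e * d)) hq
  zify at *
  nlinarith

/-- A weak form of the Hasse-Weil bound in characteristic 2. -/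
theorem exists_many_rational_points (d e B : ℕ) (hd : 0 < d) : ∃ N₀, ∀ N ≥ N₀,
    ∀ (K : Type) [Field K] [IsAlgClosed K] [CharP K 2] (F : K[X][X]), F.Monic →
    ∀ [IsDomain (AdjoinRoot F)], F.natDegree = d → (∀ i, (F.coeff i).natDegree ≤ e) →
    F.derivative ≠ 0 → (∀ i j, ((F.coeff i).coeff j) ^ 2 ^ N = (F.coeff i).coeff j) →
    ∀ S : Finset K, S.card = 2 ^ N → (∀ x ∈ S, x ^ 2 ^ N = x) →
    ∃ T : Finset (K × K), B < T.card ∧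
      ∀ P ∈ T, P.1 ∈ S ∧ P.2 ^ 2 ^ N = P.2 ∧ F.evalEval P.1 P.2 = 0 := by
  classical
  obtain ⟨D, rfl⟩ : ∃ D, d = D + 1 := ⟨d - 1, by omega⟩
  set d := D + 1 with hd'
  set l := 2 * d * (e * d + e + 2) with hl
  set κ := d * (l + e * d + e * d) with hκ
  set δ := d * (e + e * d + e * d) with hδ
  set c₀ := e * d + B + 1 + δ + l + e * d + e * d with hc₀
  refine ⟨κ + (d + 1) + c₀, fun N hN K _ _ _ F hF _ hFd he hder hFr S hS hSx ↦ ?_⟩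
  obtain ⟨t, rfl⟩ : ∃ t, N = κ + (t + (d + 1)) := ⟨N - (κ + (d + 1)), by omega⟩
  set r := 2 ^ t with hr
  have hrc : c₀ ≤ r := (by omega : c₀ ≤ t).trans (Nat.lt_two_pow_self).le
  set H := 2 ^ (d + 1) with hH
  have hH2 : 2 * d ≤ H := by
    rw [hH, pow_succ, mul_comm]
    exact Nat.mul_le_mul_right 2 (Nat.lt_two_pow_self).le
  obtain ⟨H', hH'⟩ : ∃ H', H = H' + 1 := ⟨H - 1, by omega⟩
  have hpow : 2 ^ (t + (d + 1)) = H * r := by rw [pow_add, mul_comm]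
  set q := 2 ^ κ with hq
  have hq1 : 1 ≤ q := Nat.one_le_two_pow
  obtain ⟨G, hG0, hGmem, hGz⟩ := exists_auxiliary_function hF hFd he (l := l) (m := H' * r)
    (ρ := t + (d + 1)) (κ := κ) (by rw [hFd]; exact Nat.lt_two_pow_self)
    (by
      rw [hFd, hpow]
      have := stepanov_count (d := d) (D := D) (e := e) (H := H) (H' := H') (r := r) hd'
        hH' hH2 Nat.one_le_two_pow
      rwa [← hl] at this) hFr
  rw [hFd] at hGmem
  set P := (S.sigma fun x ↦ (F.map (evalRingHom x)).roots.toFinset).image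
    fun s ↦ (s.1, s.2) with hP
  have hPall := natDegree_mul_card_le hF he hder S
  rw [← hP, hFd, hS] at hPall
  have hPmem (p : K × K) (hp : p ∈ P) : p.1 ∈ S ∧ F.evalEval p.1 p.2 = 0 := by
    obtain ⟨⟨a, b⟩, hs, rfl⟩ := Finset.mem_image.1 hp
    obtain ⟨h1, h2⟩ := Finset.mem_sigma.1 hs
    refine ⟨h1, ?_⟩
    have := isRoot_of_mem_roots (Multiset.mem_toFinset.1 h2)
    rwa [IsRoot, map_evalRingHom_eval] at this
  set N := κ + (t + (d + 1)) with hN'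
  have hsplit := Finset.card_filter_add_card_filter_not (s := P) (fun p ↦ p.2 ^ 2 ^ N = p.2)
  have hnon := card_zeros_le hF he hGmem hG0 (P.filter fun p ↦ ¬ p.2 ^ 2 ^ N = p.2) (by
    intro p hp
    obtain ⟨hp1, hp2⟩ := Finset.mem_filter.1 hp
    obtain ⟨hp3, hp4⟩ := hPmem p hp1
    exact ⟨hp4, hGz _ _ hp4 (hSx _ hp3) hp2⟩)
  rw [hFd] at hnon
  refine ⟨P.filter fun p ↦ p.2 ^ 2 ^ N = p.2, ?_, fun p hp ↦ ?_⟩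
  · have hQ : 2 ^ N = q * (H * r) := by rw [hN', pow_add, hpow]
    rw [hQ] at hPall
    by_contra! hcon
    rw [hH'] at hPall
    refine stepanov_bound (H := H') hd hq1 hrc ?_
    calc d * (q * ((H' + 1) * r)) ≤ _ := hPall
      _ ≤ _ := Nat.add_le_add_right (hsplit.symm.le.trans (Nat.add_le_add hcon hnon)) _
  · obtain ⟨hp1, hp2⟩ := Finset.mem_filter.1 hp
    exact ⟨(hPmem p hp1).1, hp2, (hPmem p hp1).2⟩

end RationalPoints

end Curve

lemma gold_identity {A : Type*} [CommRing A] [CharP A 2] (k : ℕ) (x a b : A) :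
    x ^ (2 ^ k + 1) + (a + x) ^ (2 ^ k + 1) + (x + b) ^ (2 ^ k + 1) + (a + x + b) ^ (2 ^ k + 1) =
      b * a ^ 2 ^ k + b ^ 2 ^ k * a := by
  simp only [pow_succ, add_pow_char_pow]
  have h2 : (2 : A) = 0 := CharTwo.two_eq_zero
  linear_combination (2 * x ^ 2 ^ k * x + a ^ 2 ^ k * a + a * x ^ 2 ^ k + x * a ^ 2 ^ k +
    x * b ^ 2 ^ k + b * x ^ 2 ^ k + b ^ 2 ^ k * b) * h2

section Monic

variable {A : Type*} [CommRing A] [IsDomain A] [CharP A 2]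

omit [IsDomain A] in
lemma natDegree_taylor_add_taylor_lt {g : A[X]} (hg : g.natDegree ≠ 0) (x y : A) :
    (taylor x g + taylor y g).natDegree < g.natDegree := by
  have h : (taylor x g + taylor y g).degree < (taylor x g).degree := by
    rw [← CharTwo.sub_eq_add]
    refine degree_sub_lt_left ?_ ?_ ?_
    · simp
    · have : g ≠ 0 := by rintro rfl; simp at hg
      simpa [taylor_eq_zero] using this
    · simp
  rw [degree_taylor] at h
  by_cases h0 : taylor x g + taylor y g = 0
  · rw [h0, natDegree_zero]
    exact Nat.pos_of_ne_zero hg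
  · exact natDegree_lt_natDegree h0 h

variable {k : ℕ} (hk : 2 ≤ k) {x b : A} (hb : b ≠ 0) {g : A[X]} (hg0 : g.natDegree ≠ 0)
  (hg : g.natDegree ≤ 2 ^ (k - 1) + 1) {E : A[X]}
  (hE : X * C b * (X + C b) * E = C ((X ^ (2 ^ k + 1) + g).eval x) +
    taylor x (X ^ (2 ^ k + 1) + g) + C ((X ^ (2 ^ k + 1) + g).eval (x + b)) +
    taylor (x + b) (X ^ (2 ^ k + 1) + g))
include hk hg0 hg hE

omit [IsDomain A] hk hg0 hg in
lemma slice_eq_add : X * C b * (X + C b) * E = C b * X ^ 2 ^ k +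
    (C (b ^ 2 ^ k) * X + C (g.eval x + g.eval (x + b)) + (taylor x g + taylor (x + b) g)) := by
  have h := gold_identity k (C x) X (C b)
  rw [hE]
  simp only [eval_add, eval_pow, eval_X, map_add, taylor_X_pow, map_pow, ← add_assoc] at h ⊢
  linear_combination h

omit [IsDomain A] hk hE in
lemma natDegree_slice_remainder_le :
    (C (b ^ 2 ^ k) * X + C (g.eval x + g.eval (x + b)) +
      (taylor x g + taylor (x + b) g)).natDegree ≤ 2 ^ (k - 1) := by
  have h1 := natDegree_taylor_add_taylor_lt hg0 x (x + b)
  refine natDegree_add_le_of_degree_le (natDegree_add_le_of_degree_le ?_ ?_) (by omega)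
  · exact ((natDegree_C_mul_le _ _).trans natDegree_X_le).trans Nat.one_le_two_pow
  · simp

include hb

lemma slice_natDegree_and_monic : E.natDegree = 2 ^ k - 2 ∧ E.Monic := by
  have h1 := slice_eq_add hE
  have h2 := natDegree_slice_remainder_le (x := x) (b := b) hg0 hg
  set R := C (b ^ 2 ^ k) * X + C (g.eval x + g.eval (x + b)) + (taylor x g + taylor (x + b) g)
  have hlt : R.natDegree < (C b * X ^ 2 ^ k).natDegree := by
    rw [natDegree_C_mul_X_pow _ _ hb]
    exact h2.trans_lt (Nat.pow_lt_pow_right (by norm_num) (by omega))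
  have hn := natDegree_add_eq_left_of_natDegree_lt hlt
  have hl := leadingCoeff_add_of_degree_lt' (degree_lt_degree hlt)
  rw [← h1] at hn hl
  have hXb : (X + C b).Monic := monic_X_add_C b
  have hE0 : E ≠ 0 := by
    rintro rfl
    rw [mul_zero, natDegree_zero, natDegree_C_mul_X_pow _ _ hb] at hn
    exact (pow_ne_zero k two_ne_zero) hn.symm
  have hX : X * C b ≠ 0 := mul_ne_zero X_ne_zero (C_ne_zero.2 hb)
  rw [natDegree_mul (mul_ne_zero hX hXb.ne_zero) hE0, natDegree_mul hX hXb.ne_zero,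
    natDegree_mul X_ne_zero (C_ne_zero.2 hb), natDegree_X, natDegree_C, natDegree_X_add_C,
    natDegree_C_mul_X_pow _ _ hb] at hn
  rw [leadingCoeff_mul, leadingCoeff_mul, leadingCoeff_mul, hXb.leadingCoeff, leadingCoeff_X,
    leadingCoeff_C, leadingCoeff_C_mul_X_pow] at hl
  refine ⟨by omega, mul_left_cancel₀ hb ?_⟩
  linear_combination hl

lemma slice_derivative_ne_zero : derivative E ≠ 0 := by
  intro h0
  have h1 := congr_arg derivative (slice_eq_add hE)
  have h2 := natDegree_slice_remainder_le (x := x) (b := b) hg0 hg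
  have h3 := (slice_natDegree_and_monic hk hb hg0 hg hE).1
  set R := C (b ^ 2 ^ k) * X + C (g.eval x + g.eval (x + b)) + (taylor x g + taylor (x + b) g)
  have h4 : derivative (X * C b * (X + C b) * E) = C (b ^ 2) * E := by
    have : (2 : A[X]) = 0 := CharTwo.two_eq_zero
    simp only [derivative_mul, h0, derivative_X, derivative_C, derivative_add, map_pow]
    linear_combination X * C b * E * this
  have h5 : derivative (C b * X ^ 2 ^ k + R) = derivative R := by
    have : (2 : A[X]) = 0 := CharTwo.two_eq_zero
    obtain ⟨k, rfl⟩ : ∃ i, k = i + 1 := ⟨k - 1, by omega⟩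
    simp [derivative_X_pow, pow_succ, CharTwo.two_eq_zero]
  rw [h4, h5] at h1
  have h6 := congr_arg natDegree h1
  rw [natDegree_C_mul (pow_ne_zero 2 hb), h3] at h6
  have h7 := natDegree_derivative_le R
  obtain ⟨k, rfl⟩ : ∃ i, k = i + 2 := ⟨k - 2, by omega⟩
  have h8 : 2 ^ (k + 2) = 4 * 2 ^ k := by ring
  have h9 : 2 ^ (k + 2 - 1) = 2 * 2 ^ k := by rw [show k + 2 - 1 = k + 1 by omega]; ring
  have : 1 ≤ 2 ^ k := Nat.one_le_two_pow
  omega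

end Monic

section TotalDegree

/-- The homomorphism `K[b][a] → K[y][T]`, `b ↦ T`, `a ↦ yT`. The degree in `T` of the image of a
polynomial is its total degree. -/
noncomputable def toGraded (K : Type*) [CommRing K] : K[X][X] →+* K[X][X] :=
  eval₂RingHom (eval₂RingHom (C.comp C) X) (C X * X)

variable {K : Type*} [CommRing K]

lemma coeff_coeff_toGraded (p : K[X][X]) (n i : ℕ) :
    ((toGraded K p).coeff n).coeff i = if i ≤ n then (p.coeff i).coeff (n - i) else 0 := by
  induction p using Polynomial.induction_on' with
  | add p q hp hq =>
    rw [map_add, coeff_add, coeff_add, hp, hq]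
    split_ifs <;> simp
  | monomial j p =>
    induction p using Polynomial.induction_on' with
    | add p q hp hq =>
      rw [map_add, map_add, coeff_add, coeff_add, hp, hq]
      split_ifs <;> simp
    | monomial m c =>
      have h : toGraded K (monomial j (monomial m c)) = C (C c * X ^ j) * X ^ (j + m) := by
        simp only [toGraded, coe_eval₂RingHom, eval₂_monomial, RingHom.comp_apply, mul_pow,
          map_mul, map_pow]
        ring
      rw [h, coeff_C_mul_X_pow]
      by_cases hn : n = j + m
      · subst hn
        rw [if_pos rfl, coeff_C_mul_X_pow]
        by_cases hi : i = j
        · subst hi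
          simp
        · simp [hi, coeff_monomial, Ne.symm hi]
      · rw [if_neg hn, coeff_zero]
        by_cases hi : i ≤ n
        · rw [if_pos hi, coeff_monomial]
          by_cases hj : j = i
          · rw [if_pos hj, coeff_monomial, if_neg (by omega)]
          · rw [if_neg hj, coeff_zero]
        · rw [if_neg hi]

lemma natDegree_coeff_toGraded_le (p : K[X][X]) (n : ℕ) :
    ((toGraded K p).coeff n).natDegree ≤ n := by
  rw [natDegree_le_iff_coeff_eq_zero]
  intro i hi
  rw [coeff_coeff_toGraded, if_neg (by omega)]

lemma coeff_coeff_eq_toGraded (p : K[X][X]) (m i : ℕ) :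
    (p.coeff i).coeff m = ((toGraded K p).coeff (i + m)).coeff i := by
  rw [coeff_coeff_toGraded, if_pos (by omega), Nat.add_sub_cancel_left]

lemma toGraded_injective : Function.Injective (toGraded K) := by
  intro p q h
  ext i m
  rw [coeff_coeff_eq_toGraded, h, ← coeff_coeff_eq_toGraded]

lemma natDegree_coeff_le_of_toGraded {p : K[X][X]} {d : ℕ} (h : (toGraded K p).natDegree ≤ d)
    (i : ℕ) : (p.coeff i).natDegree ≤ d := by
  rw [natDegree_le_iff_coeff_eq_zero]
  intro m hm
  rw [coeff_coeff_eq_toGraded, coeff_eq_zero_of_natDegree_lt (h.trans_lt (by omega)), coeff_zero]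

end TotalDegree

section Gap

variable {K : Type*} [Field K]

/-- A gap below the leading form of `P * Q` forces `Q` to be a leading form. -/
lemma coeff_eq_zero_of_gap {P Q : K[X][X]} {p t : ℕ} (hp : P.natDegree ≤ p) (ht : Q.natDegree ≤ t)
    (hPd : ∀ i, (P.coeff i).natDegree ≤ i) (hpd : (P.coeff p).natDegree = p)
    (hcop : IsCoprime (P.coeff p) (Q.coeff t)) (hP0 : P.coeff p ≠ 0)
    (htp : t ≤ p) (hgap : ∀ i, p ≤ i → i < p + t → (P * Q).coeff i = 0) :
    ∀ i < t, Q.coeff i = 0 := by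
  suffices h : ∀ s, 1 ≤ s → s ≤ t → P.coeff (p - s) = 0 ∧ Q.coeff (t - s) = 0 by
    intro i hi
    have := (h (t - i) (by omega) (by omega)).2
    rwa [show t - (t - i) = i by omega] at this
  intro s
  induction s using Nat.strong_induction_on with
  | _ s ih =>
  intro hs1 hst
  have hc := hgap (p + t - s) (by omega) (by omega)
  rw [coeff_mul] at hc
  have hsum : ∑ x ∈ Finset.HasAntidiagonal.antidiagonal (p + t - s), P.coeff x.1 * Q.coeff x.2 =
      P.coeff p * Q.coeff (t - s) + P.coeff (p - s) * Q.coeff t := by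
    rw [← Finset.sum_subset (s₁ := {(p, t - s), (p - s, t)})]
    · rw [Finset.sum_pair]
      simp only [ne_eq, Prod.mk.injEq, not_and]
      omega
    · intro x hx
      simp only [Finset.mem_insert, Finset.mem_singleton] at hx
      rw [Finset.HasAntidiagonal.mem_antidiagonal]
      rcases hx with rfl | rfl <;> simp only <;> omega
    · rintro ⟨u, v⟩ hx hx'
      rw [Finset.HasAntidiagonal.mem_antidiagonal] at hx
      simp only [Finset.mem_insert, Finset.mem_singleton, Prod.mk.injEq, not_or, not_and] at hx hx' ⊢
      by_cases hu : p < u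
      · rw [coeff_eq_zero_of_natDegree_lt (hp.trans_lt hu), zero_mul]
      by_cases hv : t < v
      · rw [coeff_eq_zero_of_natDegree_lt (ht.trans_lt hv), mul_zero]
      have := (ih (p - u) (by omega) (by omega) (by omega)).1
      rw [show p - (p - u) = u by omega] at this
      rw [this, zero_mul]
  rw [hsum] at hc
  have hdvd : P.coeff p ∣ P.coeff (p - s) := by
    refine hcop.dvd_of_dvd_mul_right ⟨-Q.coeff (t - s), ?_⟩
    linear_combination hc
  have hP : P.coeff (p - s) = 0 := by
    by_contra hne
    have h1 := natDegree_le_of_dvd hdvd hne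
    have h2 := hPd (p - s)
    omega
  rw [hP, zero_mul, add_zero] at hc
  exact ⟨hP, (mul_eq_zero.1 hc).resolve_left hP0⟩

/-- If `P * Q` has a gap below its separable leading form and no linear factor in `y`, then one of
`P` and `Q` is constant. -/
lemma natDegree_eq_zero_of_gap [IsAlgClosed K] {P Q : K[X][X]} {d : ℕ}
    (hPd : ∀ i, (P.coeff i).natDegree ≤ i) (hQd : ∀ i, (Q.coeff i).natDegree ≤ i)
    (hd : (P * Q).natDegree = d) (hlead : ((P * Q).coeff d).natDegree = d)
    (hsep : ((P * Q).coeff d).Separable) (hgap : ∀ i, d ≤ 2 * i → i < d → (P * Q).coeff i = 0)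
    (hroot : ∀ β, ((P * Q).coeff d).IsRoot β → ∃ i, ¬ ((P * Q).coeff i).IsRoot β)
    (hle : Q.natDegree ≤ P.natDegree) : Q.natDegree = 0 := by
  have hPQ : P * Q ≠ 0 := by
    intro h
    rw [h, coeff_zero] at hsep
    exact not_separable_zero hsep
  have hadd := natDegree_mul (left_ne_zero_of_mul hPQ) (right_ne_zero_of_mul hPQ)
  have hlc : (P * Q).coeff d = P.coeff P.natDegree * Q.coeff Q.natDegree := by
    rw [← hd, hadd, coeff_mul_degree_add_degree]
    rfl
  rw [hd] at hadd
  have hP0 : P.coeff P.natDegree ≠ 0 := leadingCoeff_ne_zero.2 (left_ne_zero_of_mul hPQ)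
  have hQ0 : Q.coeff Q.natDegree ≠ 0 := leadingCoeff_ne_zero.2 (right_ne_zero_of_mul hPQ)
  have hdeg := hlead
  rw [hlc, natDegree_mul hP0 hQ0] at hdeg
  have h1 := hPd P.natDegree
  have h2 := hQd Q.natDegree
  have hQz := coeff_eq_zero_of_gap le_rfl le_rfl hPd (by omega)
    (by rw [hlc] at hsep; exact hsep.isCoprime) hP0 hle
    (fun i hi hi' ↦ hgap i (by omega) (by omega))
  by_contra hne
  obtain ⟨β, hβ⟩ := IsAlgClosed.exists_root (Q.coeff Q.natDegree) (by
    rw [degree_eq_natDegree hQ0]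
    have : (Q.coeff Q.natDegree).natDegree ≠ 0 := by omega
    exact_mod_cast this)
  obtain ⟨i, hi⟩ := hroot β (by rw [hlc, IsRoot, eval_mul, hβ.eq_zero, mul_zero])
  refine hi ?_
  rw [IsRoot, coeff_mul, eval_finsetSum]
  refine Finset.sum_eq_zero fun x _ ↦ ?_
  rw [eval_mul]
  rcases lt_trichotomy x.2 Q.natDegree with h | h | h
  · rw [hQz _ h, eval_zero, mul_zero]
  · rw [h, hβ.eq_zero, mul_zero]
  · rw [coeff_eq_zero_of_natDegree_lt h, eval_zero, mul_zero]

end Gap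

section Line

lemma algHom_phiNum {K B : Type} [CommRing K] [CommRing B] [Algebra K B]
    (σ : MvPolynomial (Fin 3) K →ₐ[K] B) (f : K[X]) :
    σ (phiNum f) = Polynomial.aeval (σ (MvPolynomial.X 0)) f +
      Polynomial.aeval (σ (MvPolynomial.X 1)) f + Polynomial.aeval (σ (MvPolynomial.X 2)) f +
      Polynomial.aeval (σ (MvPolynomial.X 0) + σ (MvPolynomial.X 1) + σ (MvPolynomial.X 2)) f := by
  simp only [phiNum, map_add σ, ← Polynomial.aeval_algHom_apply]

variable {K A : Type} [CommRing K] [CommRing A] [Algebra K A]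

/-- Restriction of a polynomial in three variables to the line of points `(x, x + a, x + b)` with
parameter `a`, in characteristic 2. -/
noncomputable def restrictLine (K : Type) {A : Type} [CommRing K] [CommRing A] [Algebra K A]
    (x b : A) : MvPolynomial (Fin 3) K →ₐ[K] A[X] :=
  MvPolynomial.aeval (![C x, X + C x, C (x + b)] : Fin 3 → A[X])

@[simp] lemma restrictLine_X0 (x b : A) : restrictLine K x b (MvPolynomial.X 0) = C x := by
  simp [restrictLine]

@[simp] lemma restrictLine_X1 (x b : A) : restrictLine K x b (MvPolynomial.X 1) = X + C x := by
  simp [restrictLine]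

@[simp] lemma restrictLine_X2 (x b : A) : restrictLine K x b (MvPolynomial.X 2) = C (x + b) := by
  simp [restrictLine]

@[simp] lemma restrictLine_C (x b : A) (c : K) :
    restrictLine K x b (MvPolynomial.C c) = C (algebraMap K A c) :=
  (restrictLine K x b).commutes c

variable [CharP A 2]

lemma restrictLine_delta3 (x b : A) : restrictLine K x b (delta3 K) = X * C b * (X + C b) := by
  have h2 : (2 : A[X]) = 0 := CharTwo.two_eq_zero
  rw [delta3, map_mul, map_mul, map_add, map_add, map_add, restrictLine_X0, restrictLine_X1,
    restrictLine_X2, map_add C]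
  linear_combination (C x * (X * C b) + C x * (X + C b + 2 * C x) ^ 2) * h2

lemma restrictLine_phiNum (x b : A) (f : K[X]) : restrictLine K x b (phiNum f) =
    C ((f.map (algebraMap K A)).eval x) + taylor x (f.map (algebraMap K A)) +
      C ((f.map (algebraMap K A)).eval (x + b)) + taylor (x + b) (f.map (algebraMap K A)) := by
  have h (u : A[X]) : Polynomial.aeval u f = (f.map (algebraMap K A)).comp u := by
    rw [comp, eval₂_map, aeval_def]
    rfl
  have h2 : (2 : A[X]) = 0 := CharTwo.two_eq_zero
  have h3 : C x + (X + C x) + C (x + b) = X + C (x + b) := by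
    linear_combination C x * h2
  rw [algHom_phiNum, restrictLine_X0, restrictLine_X1, restrictLine_X2, h3, h, h, h, h,
    taylor_apply, taylor_apply, comp_C, comp_C]

lemma restrictLine_mul_eq (x b : A) {f : K[X]} {φ : MvPolynomial (Fin 3) K}
    (hφ : delta3 K * φ = phiNum f) :
    X * C b * (X + C b) * restrictLine K x b φ =
      C ((f.map (algebraMap K A)).eval x) + taylor x (f.map (algebraMap K A)) +
        C ((f.map (algebraMap K A)).eval (x + b)) + taylor (x + b) (f.map (algebraMap K A)) := by
  rw [← restrictLine_phiNum, ← hφ, map_mul, restrictLine_delta3]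

end Line

section Slice

variable {K : Type} [Field K]

/-- Restriction of a polynomial in three variables to a family of lines, in characteristic 2: the
parameter `b` of the family is the inner variable, and the outer variable is `a`. -/
noncomputable abbrev slice (γ : K) : MvPolynomial (Fin 3) K →ₐ[K] K[X][X] :=
  restrictLine K (C γ * X) X

variable [CharP K 2]

lemma coeff_toGraded_slice_phiNum (γ : K) (f : K[X]) (n : ℕ) :
    (toGraded K (slice γ (phiNum f))).coeff n = C (f.coeff n) *
      (C γ ^ n + (X + C γ) ^ n + (C γ + 1) ^ n + (X + C γ + 1) ^ n) := by
  have h (u : K[X][X]) (w : K[X]) (hu : toGraded K u = C w * X) :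
      (toGraded K (Polynomial.aeval u f)).coeff n = C (f.coeff n) * w ^ n := by
    rw [aeval_def, hom_eval₂, hu, ← coeff_map, ← comp_C_mul_X_coeff, comp, eval₂_map]
    congr 2
    ext a
    simp [toGraded]
  have h2 : (2 : K[X][X]) = 0 := CharTwo.two_eq_zero
  rw [algHom_phiNum, restrictLine_X0, restrictLine_X1, restrictLine_X2,
    map_add (toGraded K), map_add (toGraded K), map_add (toGraded K), coeff_add, coeff_add, coeff_add,
    h _ (C γ), h _ (X + C γ), h _ (C γ + 1), h _ (X + C γ + 1)]
  · ring
  all_goals simp only [toGraded, map_add, map_mul, coe_eval₂RingHom, eval₂_C,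
    eval₂_X, RingHom.comp_apply, map_one]
  · linear_combination C (C γ) * X * h2
  · ring
  · ring

end Slice

section SliceIrreducible

variable {K : Type} [Field K] [CharP K 2] {k : ℕ} (hk : 2 ≤ k) {g : K[X]}
  (hg : g.natDegree ≤ 2 ^ (k - 1) + 1) {φ : MvPolynomial (Fin 3) K}
  (hφ : delta3 K * φ = phiNum (X ^ (2 ^ k + 1) + g)) (γ : K)
include hk hg hφ

lemma natDegree_slice_and_monic (hg0 : g.natDegree ≠ 0) :
    (slice γ φ).natDegree = 2 ^ k - 2 ∧ (slice γ φ).Monic := by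
  refine slice_natDegree_and_monic hk (x := C γ * X) (X_ne_zero (R := K)) (g := g.map C) ?_ ?_ ?_
  · rwa [natDegree_map_eq_of_injective C_injective]
  · rwa [natDegree_map_eq_of_injective C_injective]
  · rw [restrictLine_mul_eq _ _ hφ]
    simp

lemma derivative_slice_ne_zero (hg0 : g.natDegree ≠ 0) : derivative (slice γ φ) ≠ 0 := by
  refine slice_derivative_ne_zero hk (x := C γ * X) (X_ne_zero (R := K)) (g := g.map C) ?_ ?_ ?_
  · rwa [natDegree_map_eq_of_injective C_injective]
  · rwa [natDegree_map_eq_of_injective C_injective]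
  · rw [restrictLine_mul_eq _ _ hφ]
    simp

omit hk hg in
lemma coeff_toGraded_slice (n : ℕ) :
    X * (X + 1) * (toGraded K (slice γ φ)).coeff n =
      C ((X ^ (2 ^ k + 1) + g).coeff (n + 3)) *
        (C γ ^ (n + 3) + (X + C γ) ^ (n + 3) + (C γ + 1) ^ (n + 3) +
          (X + C γ + 1) ^ (n + 3)) := by
  rw [← coeff_toGraded_slice_phiNum, ← hφ, map_mul, restrictLine_delta3, map_mul]
  have h : toGraded K (X * C X * (X + C X)) = C (X * (X + 1)) * X ^ 3 := by
    simp only [toGraded, map_add, map_mul, coe_eval₂RingHom, eval₂_C, eval₂_X, map_one]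
    ring
  rw [h, mul_right_comm (C _), coeff_mul_X_pow, coeff_C_mul]

omit hφ [CharP K 2] in
lemma coeff_gold_eq_zero {i : ℕ} (h : 2 ^ k - 2 ≤ 2 * i) (hi : i ≠ 2 ^ k - 2) :
    (X ^ (2 ^ k + 1) + g).coeff (i + 3) = 0 := by
  obtain ⟨k, rfl⟩ : ∃ i, k = i + 2 := ⟨k - 2, by omega⟩
  have h8 : 2 ^ (k + 2) = 4 * 2 ^ k := by ring
  have h9 : 2 ^ (k + 2 - 1) = 2 * 2 ^ k := by rw [show k + 2 - 1 = k + 1 by omega]; ring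
  have : 1 ≤ 2 ^ k := Nat.one_le_two_pow
  rw [coeff_add, coeff_X_pow, if_neg (by omega), coeff_eq_zero_of_natDegree_lt (by omega), add_zero]

omit hφ [CharP K 2] in
lemma coeff_gold_eq_one : (X ^ (2 ^ k + 1) + g).coeff (2 ^ k - 2 + 3) = 1 := by
  obtain ⟨k, rfl⟩ : ∃ i, k = i + 2 := ⟨k - 2, by omega⟩
  have h8 : 2 ^ (k + 2) = 4 * 2 ^ k := by ring
  have h9 : 2 ^ (k + 2 - 1) = 2 * 2 ^ k := by rw [show k + 2 - 1 = k + 1 by omega]; ring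
  have : 1 ≤ 2 ^ k := Nat.one_le_two_pow
  rw [coeff_add, coeff_X_pow, if_pos (by omega), coeff_eq_zero_of_natDegree_lt (by omega), add_zero]

lemma coeff_toGraded_slice_top :
    X * (X + 1) * (toGraded K (slice γ φ)).coeff (2 ^ k - 2) = X ^ 2 ^ k + X := by
  have h := gold_identity k (C γ) X 1
  have h4 : 2 ^ 2 ≤ 2 ^ k := Nat.pow_le_pow_right (by norm_num) hk
  rw [coeff_toGraded_slice hφ, coeff_gold_eq_one hk hg, map_one, one_mul,
    show 2 ^ k - 2 + 3 = 2 ^ k + 1 by omega, h]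
  ring

lemma natDegree_toGraded_slice_top :
    ((toGraded K (slice γ φ)).coeff (2 ^ k - 2)).natDegree = 2 ^ k - 2 := by
  have h := coeff_toGraded_slice_top hk hg hφ γ
  have h4 : 2 ^ 2 ≤ 2 ^ k := Nat.pow_le_pow_right (by norm_num) hk
  have h1 : (X ^ 2 ^ k + X : K[X]).natDegree = 2 ^ k := by
    rw [natDegree_add_eq_left_of_natDegree_lt, natDegree_X_pow]
    rw [natDegree_X_pow, natDegree_X]
    omega
  rw [← h, natDegree_mul, natDegree_mul X_ne_zero, natDegree_X] at h1
  · rw [show (X + 1 : K[X]) = X + C 1 from rfl, natDegree_X_add_C] at h1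
    omega
  · exact X_add_C_ne_zero 1
  · exact mul_ne_zero X_ne_zero (X_add_C_ne_zero 1)
  · intro h0
    rw [h0, mul_zero, natDegree_zero] at h1
    omega

lemma natDegree_toGraded_slice :
    (toGraded K (slice γ φ)).natDegree = 2 ^ k - 2 := by
  have h4 : 2 ^ 2 ≤ 2 ^ k := Nat.pow_le_pow_right (by norm_num) hk
  refine le_antisymm (natDegree_le_iff_coeff_eq_zero.2 fun i hi ↦ ?_)
    (le_natDegree_of_ne_zero fun h0 ↦ ?_)
  · have := coeff_toGraded_slice hφ γ i
    rw [coeff_gold_eq_zero hk hg (by omega) (by omega), map_zero, zero_mul] at this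
    exact (mul_eq_zero.1 this).resolve_left (mul_ne_zero X_ne_zero (X_add_C_ne_zero 1))
  · have := natDegree_toGraded_slice_top hk hg hφ γ
    rw [h0, natDegree_zero] at this
    omega

lemma irreducible_slice [IsAlgClosed K] {j : ℕ} (hj3 : 3 ≤ j) (hj : g.coeff j ≠ 0)
    (hγ : ∀ β : K, β ^ 2 ^ k = β → β ≠ 0 → β ≠ 1 →
      γ ^ j + (β + γ) ^ j + (γ + 1) ^ j + (β + γ + 1) ^ j ≠ 0) :
    Irreducible (slice γ φ) := by
  have h4 : 2 ^ 2 ≤ 2 ^ k := Nat.pow_le_pow_right (by norm_num) hk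
  have h2 : (2 : K) = 0 := CharTwo.two_eq_zero
  have hjg : j ≤ g.natDegree := le_natDegree_of_ne_zero hj
  have hjk : j < 2 ^ k + 1 := by
    have : 2 ^ (k - 1) < 2 ^ k := Nat.pow_lt_pow_right (by norm_num) (by omega)
    omega
  obtain ⟨hdeg, hmonic⟩ := natDegree_slice_and_monic hk hg hφ γ (by omega)
  have hgdeg := natDegree_toGraded_slice hk hg hφ γ
  have htop := coeff_toGraded_slice_top hk hg hφ γ
  have htopdeg := natDegree_toGraded_slice_top hk hg hφ γ
  have hcoef := coeff_toGraded_slice hφ γ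
  set h := (toGraded K (slice γ φ)).coeff (2 ^ k - 2) with hh
  have hder : derivative (X ^ 2 ^ k + X : K[X]) = 1 := by
    have h20 : (2 : K[X]) = 0 := CharTwo.two_eq_zero
    obtain ⟨k, rfl⟩ : ∃ i, k = i + 1 := ⟨k - 1, by omega⟩
    simp [derivative_X_pow, pow_succ, h2]
  have hsep : h.Separable := by
    have : (X ^ 2 ^ k + X : K[X]).Separable := by
      rw [Separable, hder]
      exact isCoprime_one_right
    rw [← htop] at this
    exact this.of_mul_right
  have hunit (P Q : K[X][X]) (hPQ : slice γ φ = P * Q)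
      (hle : (toGraded K Q).natDegree ≤ (toGraded K P).natDegree) : IsUnit Q := by
    have hmul : toGraded K P * toGraded K Q = toGraded K (slice γ φ) := by rw [hPQ, map_mul]
    have h0 := natDegree_eq_zero_of_gap (natDegree_coeff_toGraded_le P)
      (natDegree_coeff_toGraded_le Q) (d := 2 ^ k - 2) (by rw [hmul, hgdeg])
      (by rw [hmul]; exact htopdeg) (by rw [hmul]; exact hsep) (by
        intro i hi hi'
        have := hcoef i
        rw [coeff_gold_eq_zero hk hg hi hi'.ne, map_zero, zero_mul] at this
        rw [hmul]
        exact (mul_eq_zero.1 this).resolve_left (mul_ne_zero X_ne_zero (X_add_C_ne_zero 1))) (by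
        intro β hβ
        rw [hmul] at hβ ⊢
        have hβh : eval β h = 0 := hβ
        have e1 := congr_arg (eval β) htop
        have e2 := congr_arg (fun p ↦ eval β (derivative p)) htop
        rw [hder] at e2
        simp only [derivative_mul, derivative_add, derivative_X, derivative_one, eval_add, eval_mul,
          eval_X, eval_one, eval_pow, hβh, mul_zero, add_zero, zero_add] at e1 e2
        have hβ0 : β ≠ 0 := by
          rintro rfl
          simp at e2
        have hβ1 : β ≠ 1 := by
          rintro rfl
          rw [show (1 : K) + 1 = 0 by rw [one_add_one_eq_two, h2]] at e2
          simp at e2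
        refine ⟨j - 3, fun hroot ↦ ?_⟩
        have e3 := congr_arg (eval β) (hcoef (j - 3))
        rw [show j - 3 + 3 = j by omega, coeff_add, coeff_X_pow, if_neg hjk.ne, zero_add] at e3
        simp only [eval_add, eval_mul, eval_X, eval_one, eval_pow, eval_C, hroot.eq_zero,
          mul_zero] at e3
        refine hγ β ?_ hβ0 hβ1 ((mul_eq_zero.1 e3.symm).resolve_left hj)
        linear_combination -e1 - β * h2) hle
    obtain ⟨p, hp⟩ := natDegree_eq_zero.1 h0
    have h1 : p.natDegree = 0 := by
      have := natDegree_coeff_toGraded_le Q 0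
      rw [← hp, coeff_C_zero] at this
      omega
    obtain ⟨c, rfl⟩ := natDegree_eq_zero.1 h1
    have hQ : Q = C (C c) := by
      apply toGraded_injective
      rw [← hp]
      simp [toGraded]
    rw [hQ, isUnit_C, isUnit_C, isUnit_iff_ne_zero]
    rintro rfl
    rw [hPQ, hQ, map_zero, map_zero, mul_zero] at hmonic
    exact hmonic.ne_zero rfl
  refine ⟨fun hu ↦ ?_, fun P Q hPQ ↦ ?_⟩
  · have := natDegree_eq_zero_of_isUnit hu
    omega
  · rcases le_total (toGraded K Q).natDegree (toGraded K P).natDegree with hle | hle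
    · exact Or.inr (hunit P Q hPQ hle)
    · exact Or.inl (hunit Q P (by rw [hPQ, mul_comm]) hle)

end SliceIrreducible

section Parameter

variable {K : Type} [Field K] [CharP K 2]

lemma dvd_of_aeval_eq_zero {K : Type} [Field K] (r : MvPolynomial (Fin 3) K)
    {p : MvPolynomial (Fin 3) K}
    (h : MvPolynomial.aeval ![MvPolynomial.X 0, r, MvPolynomial.X 2] p = 0) :
    MvPolynomial.X 1 - r ∣ p := by
  let mk := Ideal.Quotient.mkₐ K (Ideal.span {MvPolynomial.X 1 - r})
  have h1 : mk.comp (MvPolynomial.aeval ![MvPolynomial.X 0, r, MvPolynomial.X 2]) = mk := by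
    refine MvPolynomial.algHom_ext fun i ↦ ?_
    fin_cases i
    · simp
    · simp only [Fin.mk_one, AlgHom.comp_apply, MvPolynomial.aeval_X, Matrix.cons_val_one,
        Matrix.cons_val_zero]
      refine (Ideal.Quotient.eq.2 ?_).symm
      exact Ideal.mem_span_singleton_self _
    · simp
  have h2 : mk p = 0 := by rw [← h1, AlgHom.comp_apply, h, map_zero]
  exact Ideal.mem_span_singleton.1 (Ideal.Quotient.eq_zero_iff_mem.1 h2)

lemma sum_pow_ne_zero_of_irreducible [Infinite K] {j : ℕ} {φ : MvPolynomial (Fin 3) K}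
    (hφ : delta3 K * φ = phiJNum K j) (hirr : Irreducible φ) {β : K} (hβ0 : β ≠ 0)
    (hβ1 : β ≠ 1) : (X ^ j + (C β + X) ^ j + (X + 1) ^ j + (C β + X + 1) ^ j : K[X]) ≠ 0 := by
  intro hzero
  have h2 : (2 : K) = 0 := CharTwo.two_eq_zero
  have hβ1' : β + 1 ≠ 0 := fun h ↦ hβ1 (by linear_combination h - h2)
  have hzero' (γ : K) : γ ^ j + (β + γ) ^ j + (γ + 1) ^ j + (β + γ + 1) ^ j = 0 := by
    simpa using congr_arg (eval γ) hzero
  set r : MvPolynomial (Fin 3) K :=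
    MvPolynomial.X 0 + MvPolynomial.C β * (MvPolynomial.X 0 + MvPolynomial.X 2) with hr
  set ρ : MvPolynomial (Fin 3) K →ₐ[K] MvPolynomial (Fin 3) K :=
    MvPolynomial.aeval ![MvPolynomial.X 0, r, MvPolynomial.X 2] with hρ
  have hρ0 : ρ (MvPolynomial.X 0) = MvPolynomial.X 0 := by simp [hρ]
  have hρ1 : ρ (MvPolynomial.X 1) = r := by simp [hρ]
  have hρ2 : ρ (MvPolynomial.X 2) = MvPolynomial.X 2 := by simp [hρ]
  have hnum : ρ (phiJNum K j) = 0 := by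
    refine MvPolynomial.funext fun v ↦ ?_
    simp only [phiJNum, map_add, map_pow, hρ0, hρ1, hρ2, hr, map_mul, MvPolynomial.eval_X,
      MvPolynomial.eval_C, map_zero]
    by_cases ht : v 0 + v 2 = 0
    · rw [ht, mul_zero, add_zero, show v 2 = v 0 by linear_combination ht - v 0 * h2,
        show v 0 + v 0 + v 0 = v 0 by linear_combination v 0 * h2]
      linear_combination 2 * v 0 ^ j * h2
    · have h := hzero' (v 0 / (v 0 + v 2))
      have e0 : v 0 = (v 0 / (v 0 + v 2)) * (v 0 + v 2) := by field_simp
      have e1 : v 0 + β * (v 0 + v 2) = (β + v 0 / (v 0 + v 2)) * (v 0 + v 2) := by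
        field_simp
        ring
      have e2 : v 2 = (v 0 / (v 0 + v 2) + 1) * (v 0 + v 2) := by
        field_simp
        linear_combination -v 0 * h2
      have e3 : v 0 + (v 0 + β * (v 0 + v 2)) + v 2 =
          (β + v 0 / (v 0 + v 2) + 1) * (v 0 + v 2) := by
        field_simp
        ring
      rw [e3, e1, show v 0 ^ j = ((v 0 / (v 0 + v 2)) * (v 0 + v 2)) ^ j by rw [← e0],
        show v 2 ^ j = ((v 0 / (v 0 + v 2) + 1) * (v 0 + v 2)) ^ j by rw [← e2],
        mul_pow, mul_pow, mul_pow, mul_pow]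
      linear_combination (v 0 + v 2) ^ j * h
  have hdelta : ρ (delta3 K) ≠ 0 := by
    intro h
    have := congr_arg (MvPolynomial.eval ![0, 0, 1]) h
    simp only [delta3, map_add, map_mul, hρ0, hρ1, hρ2, hr, MvPolynomial.eval_X,
      MvPolynomial.eval_C, map_zero] at this
    simp [hβ0, hβ1'] at this
  have hρφ : ρ φ = 0 := by
    rw [← hφ, map_mul] at hnum
    exact (mul_eq_zero.1 hnum).resolve_left hdelta
  obtain ⟨c, hc⟩ := dvd_of_aeval_eq_zero r hρφ
  rcases hirr.isUnit_or_isUnit hc with hu | hu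
  · have := hu.map (MvPolynomial.eval (0 : Fin 3 → K))
    simp [hr] at this
  · obtain ⟨u, hu0, rfl⟩ := MvPolynomial.isUnit_iff_eq_C_of_isReduced.1 hu
    rw [hc] at hφ
    have e1 := congr_arg (MvPolynomial.eval ![0, 1, β]) hφ
    have e2 := congr_arg (MvPolynomial.eval ![0, β, 1]) hφ
    simp only [delta3, phiJNum, hr, map_add, map_mul, map_sub, map_pow, MvPolynomial.eval_X,
      MvPolynomial.eval_C, Matrix.cons_val_zero, Matrix.cons_val_one, Matrix.cons_val] at e1 e2
    have : β * (β + 1) ^ 3 * u = 0 := by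
      rw [show (0 : K) + β + 1 = 0 + 1 + β by ring] at e2
      linear_combination e1 - e2 + (β * (β + 1) ^ 2 * β * u) * h2
    simp [hβ0, hβ1', hu0.ne_zero] at this

lemma exists_sum_pow_ne_zero [Infinite K] {j k : ℕ} {φ : MvPolynomial (Fin 3) K}
    (hφ : delta3 K * φ = phiJNum K j) (hirr : Irreducible φ) (hk : k ≠ 0) (S : Finset K)
    (hS : 2 ^ k * j < S.card) :
    ∃ γ ∈ S, ∀ β : K, β ^ 2 ^ k = β → β ≠ 0 → β ≠ 1 →
      γ ^ j + (β + γ) ^ j + (γ + 1) ^ j + (β + γ + 1) ^ j ≠ 0 := by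
  classical
  have h2k : 1 < 2 ^ k := Nat.one_lt_two_pow hk
  let R : Finset K := (X ^ 2 ^ k - X : K[X]).roots.toFinset.filter fun β ↦ β ≠ 0 ∧ β ≠ 1
  have hR : R.card ≤ 2 ^ k := by
    refine (Finset.card_filter_le _ _).trans ((Multiset.toFinset_card_le _).trans
      ((card_roots' _).trans ?_))
    rw [FiniteField.X_pow_card_sub_X_natDegree_eq _ h2k]
  let P : K[X] := ∏ β ∈ R, (X ^ j + (C β + X) ^ j + (X + 1) ^ j + (C β + X + 1) ^ j)
  have hP : P ≠ 0 := Finset.prod_ne_zero_iff.2 fun β hβ ↦ by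
    obtain ⟨-, h0, h1⟩ := Finset.mem_filter.1 hβ
    exact sum_pow_ne_zero_of_irreducible hφ hirr h0 h1
  have hdeg : P.natDegree ≤ 2 ^ k * j := by
    refine (natDegree_prod_le _ _).trans ((Finset.sum_le_card_nsmul _ _ j fun β _ ↦ ?_).trans ?_)
    · compute_degree
    · exact Nat.mul_le_mul_right j hR
  obtain ⟨γ, hγ, hγP⟩ : ∃ γ ∈ S, γ ∉ P.roots.toFinset := by
    refine Finset.exists_mem_notMem_of_card_lt_card (lt_of_le_of_lt ?_ hS)
    exact (Multiset.toFinset_card_le _).trans ((card_roots' _).trans hdeg)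
  refine ⟨γ, hγ, fun β hβ h0 h1 hz ↦ hγP ?_⟩
  rw [Multiset.mem_toFinset, mem_roots hP, IsRoot.def, eval_prod]
  refine Finset.prod_eq_zero (i := β) ?_ (by simpa using hz)
  rw [Finset.mem_filter, Multiset.mem_toFinset,
    mem_roots (FiniteField.X_pow_card_sub_X_ne_zero _ h2k)]
  exact ⟨by simp [hβ], h0, h1⟩

end Parameter

section Lift

lemma map_restrictLine {K A B : Type} [CommRing K] [CommRing A] [Algebra K A] [CommRing B]
    [Algebra K B] (σ : A →ₐ[K] B) (x b : A) (p : MvPolynomial (Fin 3) K) :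
    (restrictLine K x b p).map (σ : A →+* B) = restrictLine K (σ x) (σ b) p := by
  have h : (mapRingHom (σ : A →+* B)).comp
      (restrictLine K x b : MvPolynomial (Fin 3) K →+* A[X]) =
      (restrictLine K (σ x) (σ b) : MvPolynomial (Fin 3) K →+* B[X]) := by
    refine MvPolynomial.ringHom_ext (fun c ↦ ?_) fun i ↦ ?_
    · simp
    · fin_cases i <;> simp
  exact DFunLike.congr_fun h p

variable {K : Type} [Field K] [CharP K 2]

lemma isLocalHom_restrictLine :
    IsLocalHom (restrictLine K (X : K[X][X]) (C X)) where
  map_nonunit p hp := by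
    let τ : K[X][X][X] →+* MvPolynomial (Fin 3) K :=
      eval₂RingHom (eval₂RingHom (eval₂RingHom MvPolynomial.C
        (MvPolynomial.X 0 + MvPolynomial.X 2)) (MvPolynomial.X 0))
        (MvPolynomial.X 0 + MvPolynomial.X 1)
    have h2 : (2 : MvPolynomial (Fin 3) K) = 0 := CharTwo.two_eq_zero
    have h : τ.comp (restrictLine K (X : K[X][X]) (C X) : MvPolynomial (Fin 3) K →+* K[X][X][X]) =
        RingHom.id _ := by
      refine MvPolynomial.ringHom_ext (fun c ↦ ?_) fun i ↦ ?_
      · simp [algebraMap_apply, τ]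
      · fin_cases i <;> simp [τ]
        · linear_combination MvPolynomial.X 0 * h2
        · linear_combination MvPolynomial.X 0 * h2
    have := hp.map τ
    rwa [show τ (restrictLine K (X : K[X][X]) (C X) p) = p from DFunLike.congr_fun h p] at this

lemma irreducible_of_irreducible_slice {k : ℕ} (hk : 2 ≤ k) {g : K[X]} (hg0 : g.natDegree ≠ 0)
    (hg : g.natDegree ≤ 2 ^ (k - 1) + 1) {φ : MvPolynomial (Fin 3) K}
    (hφ : delta3 K * φ = phiNum (X ^ (2 ^ k + 1) + g)) {γ : K} (h : Irreducible (slice γ φ)) :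
    Irreducible φ := by
  have hinj := FaithfulSMul.algebraMap_injective K K[X][X]
  have hmonic : (restrictLine K (X : K[X][X]) (C X) φ).Monic := by
    refine (slice_natDegree_and_monic hk (x := X) (C_ne_zero.2 (X_ne_zero (R := K)))
      (g := g.map (algebraMap K K[X][X])) ?_ ?_ ?_).2
    · rwa [natDegree_map_eq_of_injective hinj]
    · rwa [natDegree_map_eq_of_injective hinj]
    · rw [restrictLine_mul_eq _ _ hφ]
      simp
  have := isLocalHom_restrictLine (K := K)
  let σ : K[X][X] →ₐ[K] K[X] := (Polynomial.aeval (R := K[X]) (C γ * X)).restrictScalars K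
  refine Irreducible.of_map (f := restrictLine K (X : K[X][X]) (C X)) ?_
  refine hmonic.irreducible_of_irreducible_map (σ : K[X][X] →+* K[X]) _ ?_
  rw [map_restrictLine]
  simpa [σ] using h

end Lift

section Rational

lemma algebraMap_phiNum {M K : Type} [Field M] [Field K] [Algebra M K] (f : M[X]) :
    MvPolynomial.map (algebraMap M K) (phiNum f) = phiNum (f.map (algebraMap M K)) := by
  have h (u : MvPolynomial (Fin 3) M) : MvPolynomial.map (algebraMap M K) (Polynomial.aeval u f) =
      Polynomial.aeval (MvPolynomial.map (algebraMap M K) u) (f.map (algebraMap M K)) := by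
    rw [aeval_def, hom_eval₂, aeval_def, eval₂_map]
    congr 1
    ext
    simp [MvPolynomial.algebraMap_eq]
  simp [phiNum, h]

lemma algebraMap_delta3 {M K : Type} [Field M] [Field K] [Algebra M K] :
    MvPolynomial.map (algebraMap M K) (delta3 M) = delta3 K := by
  simp [delta3]

lemma slice_map {M K : Type} [Field M] [Field K] [Algebra M K] (γ : M)
    (p : MvPolynomial (Fin 3) M) :
    slice (algebraMap M K γ) (MvPolynomial.map (algebraMap M K) p) =
      (slice γ p).map (mapRingHom (algebraMap M K)) := by
  have h : ((slice (algebraMap M K γ) : MvPolynomial (Fin 3) K →+* K[X][X])).comp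
      (MvPolynomial.map (algebraMap M K)) = (mapRingHom (mapRingHom (algebraMap M K))).comp
      (slice γ : MvPolynomial (Fin 3) M →+* M[X][X]) := by
    refine MvPolynomial.ringHom_ext (fun c ↦ ?_) fun i ↦ ?_
    · simp [Polynomial.algebraMap_apply]
    · fin_cases i <;> simp
  exact DFunLike.congr_fun h p

lemma exists_many_nondegenerate_points (d e : ℕ) (hd : 2 ≤ d) : ∃ N₀, ∀ N ≥ N₀,
    ∀ (K : Type) [Field K] [IsAlgClosed K] [CharP K 2] (F : K[X][X]), F.Monic →
    Irreducible F → F.natDegree = d → (∀ i, (F.coeff i).natDegree ≤ e) →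
    F.derivative ≠ 0 → (∀ i j, ((F.coeff i).coeff j) ^ 2 ^ N = (F.coeff i).coeff j) →
    ∀ S : Finset K, S.card = 2 ^ N → (∀ x ∈ S, x ^ 2 ^ N = x) →
    ∃ b ∈ S, ∃ a, a ^ 2 ^ N = a ∧ a ≠ 0 ∧ b ≠ 0 ∧ a + b ≠ 0 ∧ F.evalEval b a = 0 := by
  obtain ⟨N₀, hN₀⟩ := exists_many_rational_points d e (d * (2 + e * 3 + e * d)) (by omega)
  refine ⟨N₀, fun N hN K _ _ _ F hF hirr hFd he hder hfix S hS hSx ↦ ?_⟩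
  have : IsDomain (AdjoinRoot F) := AdjoinRoot.isDomain_of_prime hirr.prime
  obtain ⟨T, hT, hTS⟩ := hN₀ N hN K F hF hFd he hder hfix S hS hSx
  by_contra! hcon
  set p : K[X][X] := X * C X * (X + C X) with hp
  have hpd : p.natDegree ≤ 3 := by rw [hp]; compute_degree!
  have hpc (i : ℕ) : (p.coeff i).natDegree ≤ 2 := by
    rw [show p = C X * X ^ 2 + C (X ^ 2) * X ^ 1 by rw [hp, map_pow]; ring, coeff_add,
      coeff_C_mul_X_pow, coeff_C_mul_X_pow]
    refine natDegree_add_le_of_degree_le ?_ ?_ <;> split_ifs <;> simp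
  have hmk : AdjoinRoot.mk F p ≠ 0 := by
    rw [hp, map_mul, map_mul]
    refine mul_ne_zero (mul_ne_zero ?_ ?_) ?_
    · exact AdjoinRoot.mk_ne_zero_of_natDegree_lt hF X_ne_zero (by rw [natDegree_X]; omega)
    · exact AdjoinRoot.mk_ne_zero_of_natDegree_lt hF (C_ne_zero.2 X_ne_zero)
        (by rw [natDegree_C]; omega)
    · exact AdjoinRoot.mk_ne_zero_of_natDegree_lt hF (X_add_C_ne_zero X)
        (by rw [natDegree_X_add_C]; omega)
  have hle := card_zeros_le hF he (mk_mem_coordDegreeLE hF he hpc) hmk T fun P hP ↦ by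
    obtain ⟨h1, h2, h3⟩ := hTS P hP
    refine ⟨h3, ?_⟩
    rw [curveEval_mk, hp]
    simp only [evalEval_mul, evalEval_add, evalEval_X, evalEval_C, eval_X]
    by_contra hne
    simp only [mul_eq_zero, not_or] at hne
    exact hcon _ h1 _ h2 hne.1.1 hne.1.2 hne.2 h3
  rw [hFd] at hle
  refine absurd (hT.trans_le hle) (not_lt.2 ?_)
  gcongr

lemma exists_eval_sum_eq_zero {k : ℕ} (hk : 2 ≤ k) : ∃ N₀, ∀ N ≥ N₀,
    ∀ (M K : Type) [Field M] [Fintype M] [CharP M 2] [Field K] [IsAlgClosed K] [Algebra M K],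
    Fintype.card M = 2 ^ N → ∀ g : M[X], g.natDegree ≤ 2 ^ (k - 1) + 1 →
    ∀ j, 3 ≤ j → g.coeff j ≠ 0 → ∀ ψ : MvPolynomial (Fin 3) K, delta3 K * ψ = phiJNum K j →
    Irreducible ψ → ∀ φ : MvPolynomial (Fin 3) M, delta3 M * φ = phiNum (X ^ (2 ^ k + 1) + g) →
    ∃ x a b : M, a ≠ 0 ∧ b ≠ 0 ∧ a + b ≠ 0 ∧
      (X ^ (2 ^ k + 1) + g).eval x + (X ^ (2 ^ k + 1) + g).eval (x + a) +
      (X ^ (2 ^ k + 1) + g).eval (x + b) + (X ^ (2 ^ k + 1) + g).eval (x + a + b) = 0 := by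
  classical
  have h4 : 2 ^ 2 ≤ 2 ^ k := Nat.pow_le_pow_right (by norm_num) hk
  obtain ⟨N₀, hN₀⟩ := exists_many_nondegenerate_points (2 ^ k - 2) (2 ^ k - 2) (by omega)
  refine ⟨max N₀ (2 ^ k * (2 ^ (k - 1) + 1)), ?_⟩
  intro N hN M K _ _ _ _ _ _ hM g hg j hj3 hj ψ hψ hψi φ hφ
  have hinj := FaithfulSMul.algebraMap_injective M K
  have : CharP K 2 := charP_of_injective_algebraMap hinj 2
  have hjg : j ≤ g.natDegree := le_natDegree_of_ne_zero hj
  let S : Finset K := Finset.univ.image (algebraMap M K)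
  have hS : S.card = 2 ^ N := by
    rw [Finset.card_image_of_injective _ hinj, Finset.card_univ, hM]
  have hSx : ∀ x ∈ S, x ^ 2 ^ N = x := by
    intro x hx
    obtain ⟨y, -, rfl⟩ := Finset.mem_image.1 hx
    rw [← map_pow, ← hM, FiniteField.pow_card]
  obtain ⟨_, hγ, hγβ⟩ := exists_sum_pow_ne_zero hψ hψi (k := k) (by omega) S (by
    rw [hS]
    refine lt_of_le_of_lt ?_ Nat.lt_two_pow_self
    exact (Nat.mul_le_mul_left _ (hjg.trans hg)).trans (le_of_max_le_right hN))
  obtain ⟨γ, -, rfl⟩ := Finset.mem_image.1 hγ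
  set φK := MvPolynomial.map (algebraMap M K) φ with hφKdef
  set gK := g.map (algebraMap M K) with hgKdef
  have hφK : delta3 K * φK = phiNum (X ^ (2 ^ k + 1) + gK) := by
    rw [← algebraMap_delta3 (M := M), ← map_mul, hφ, algebraMap_phiNum]
    simp [hgKdef]
  have hgK : gK.natDegree = g.natDegree := natDegree_map_eq_of_injective hinj g
  have hgK' : gK.natDegree ≤ 2 ^ (k - 1) + 1 := by rwa [hgK]
  have hgK0 : gK.natDegree ≠ 0 := by omega
  obtain ⟨hdeg, hmonic⟩ := natDegree_slice_and_monic hk hgK' hφK (algebraMap M K γ) hgK0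
  have hslice := slice_map (K := K) γ φ
  obtain ⟨_, hb, a, ha, ha0, hb0, hab, hE⟩ := hN₀ N (le_of_max_le_left hN) K _ hmonic
    (irreducible_slice hk hgK' hφK _ hj3
      (by rwa [hgKdef, coeff_map, map_ne_zero_iff _ hinj]) hγβ) hdeg
    (natDegree_coeff_le_of_toGraded (natDegree_toGraded_slice hk hgK' hφK _).le)
    (derivative_slice_ne_zero hk hgK' hφK _ hgK0) (fun i m ↦ by
      rw [hslice, coeff_map, coe_mapRingHom, coeff_map, ← map_pow, ← hM, FiniteField.pow_card])
    S hS hSx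
  obtain ⟨b, -, rfl⟩ := Finset.mem_image.1 hb
  obtain ⟨a, rfl⟩ : ∃ a', algebraMap M K a' = a := by
    by_contra hcon
    have hN0 : 1 < 2 ^ N := by rw [← hM]; exact Fintype.one_lt_card
    have haS : a ∉ S := fun h ↦ by
      obtain ⟨y, -, hy⟩ := Finset.mem_image.1 h
      exact hcon ⟨y, hy⟩
    have hle : (insert a S).card ≤ (X ^ 2 ^ N - X : K[X]).roots.toFinset.card := by
      refine Finset.card_le_card fun x hx ↦ ?_
      have hx' : x ^ 2 ^ N = x := by
        rcases Finset.mem_insert.1 hx with rfl | hx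
        · exact ha
        · exact hSx x hx
      rw [Multiset.mem_toFinset, mem_roots (FiniteField.X_pow_card_sub_X_ne_zero _ hN0)]
      simp [hx']
    rw [Finset.card_insert_of_notMem haS, hS] at hle
    have := (hle.trans (Multiset.toFinset_card_le _)).trans (card_roots' _)
    rw [FiniteField.X_pow_card_sub_X_natDegree_eq _ hN0] at this
    omega
  refine ⟨γ * b, a, b, ?_, ?_, ?_, ?_⟩
  · rintro rfl; simp at ha0
  · rintro rfl; simp at hb0
  · intro h; rw [← map_add, h, map_zero] at hab; exact hab rfl
  rw [hslice] at hE
  let σ : MvPolynomial (Fin 3) M →ₐ[M] M :=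
    ((Polynomial.aeval b).comp ((Polynomial.aeval (C a : M[X])).restrictScalars M)).comp (slice γ)
  have hσφ : σ φ = 0 := by
    apply hinj
    rw [map_zero, ← hE, map_mapRingHom_evalEval]
    simp [σ, evalEval]
  have hσ := algHom_phiNum σ (X ^ (2 ^ k + 1) + g)
  rw [← hφ, map_mul, hσφ, mul_zero] at hσ
  have e0 : σ (MvPolynomial.X 0) = γ * b := by simp [σ]
  have e1 : σ (MvPolynomial.X 1) = γ * b + a := by simp [σ, add_comm]
  have e2 : σ (MvPolynomial.X 2) = γ * b + b := by simp [σ]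
  have h2 : (2 : M) = 0 := CharTwo.two_eq_zero
  rw [e0, e1, e2, show γ * b + (γ * b + a) + (γ * b + b) = γ * b + a + b by
    linear_combination γ * b * h2] at hσ
  simpa only [coe_aeval_eq_eval] using hσ.symm

end Rational

end Polynomial

lemma not_isAPN_of_sum_eq_zero {M : Type} [Field M] [Fintype M] [CharP M 2] {f : M → M}
    {x a b : M} (ha : a ≠ 0) (hb : b ≠ 0) (hab : a + b ≠ 0)
    (h : f x + f (x + a) + f (x + b) + f (x + a + b) = 0) : ¬ IsAPN f := by
  classical
  intro hf
  have h2 : (2 : M) = 0 := CharTwo.two_eq_zero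
  have hsub : (({x, x + a, x + b} : Finset M) : Set M) ⊆
      {y : M | f (y + a) + f y = f (x + a) + f x} := by
    intro y hy
    simp only [Finset.coe_insert, Finset.coe_singleton, Set.mem_insert_iff,
      Set.mem_singleton_iff] at hy
    rcases hy with rfl | rfl | rfl
    · rfl
    · change f (x + a + a) + f (x + a) = f (x + a) + f x
      rw [add_assoc x a a, CharTwo.add_self_eq_zero, add_zero, add_comm]
    · change f (x + b + a) + f (x + b) = f (x + a) + f x
      rw [add_right_comm]
      linear_combination h - (f (x + a) + f x) * h2
  have hcard : ({x, x + a, x + b} : Finset M).card = 3 := by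
    refine Finset.card_eq_three.2 ⟨_, _, _, ?_, ?_, ?_, rfl⟩
    · simpa using ha
    · simpa using hb
    · intro h
      exact hab (by linear_combination h + b * h2)
  have := (Set.ncard_le_ncard hsub (Set.toFinite _)).trans (hf a _ ha)
  rw [Set.ncard_coe_finset, hcard] at this
  omega

/-- Let `L = F_q`, `q = 2^n`, and `f(x) = x^{2^k+1} + g(x)` with
`deg g ≤ 2^{k-1} + 1`. If there is an index `j ≥ 3` with `g.coeff j ≠ 0` such that
`φ_j` is absolutely irreducible, then `φ` is absolutely irreducible and `f` is not
exceptional APN. -/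
theorem gold_plus_small_perturbation_abs_irred {n : ℕ} (hn : 0 < n) (L : Type)
    [Field L] [Fintype L] (hcard : Fintype.card L = 2 ^ n)
    (k : ℕ) (hk : 1 ≤ k) (g : Polynomial L)
    (hg : g.natDegree ≤ 2 ^ (k - 1) + 1)
    (f : Polynomial L) (hf : f = Polynomial.X ^ (2 ^ k + 1) + g)
    (j : ℕ) (hj3 : 3 ≤ j) (hcoeff : g.coeff j ≠ 0)
    (φj : MvPolynomial (Fin 3) L) (hφj : delta3 L * φj = phiJNum L j)
    (hφj_irr : AbsolutelyIrreducible φj)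
    (φ : MvPolynomial (Fin 3) L) (hφ : delta3 L * φ = phiNum f) :
    AbsolutelyIrreducible φ ∧ ¬ IsExceptionalAPN f := by
  subst hf
  have hjg : j ≤ g.natDegree := Polynomial.le_natDegree_of_ne_zero hcoeff
  have hk2 : 2 ≤ k := by
    by_contra h
    obtain rfl : k = 1 := by omega
    norm_num at hg
    omega
  have : CharP L 2 := charP_of_card_eq_prime_pow hcard
  set K := AlgebraicClosure L
  have hinj := FaithfulSMul.algebraMap_injective L K
  have : CharP K 2 := charP_of_injective_algebraMap hinj 2
  have hψ : delta3 K * MvPolynomial.map (algebraMap L K) φj = phiJNum K j := by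
    rw [← Polynomial.algebraMap_delta3 (M := L), ← map_mul, hφj]
    simp [phiJNum]
  have hφK : delta3 K * MvPolynomial.map (algebraMap L K) φ =
      phiNum (Polynomial.X ^ (2 ^ k + 1) + g.map (algebraMap L K)) := by
    rw [← Polynomial.algebraMap_delta3 (M := L), ← map_mul, hφ, Polynomial.algebraMap_phiNum]
    simp
  have hgK : (g.map (algebraMap L K)).natDegree = g.natDegree :=
    Polynomial.natDegree_map_eq_of_injective hinj g
  refine ⟨?_, fun hexc ↦ ?_⟩
  · obtain ⟨S, hS⟩ := Infinite.exists_subset_card_eq K (2 ^ k * j + 1)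
    obtain ⟨γ, -, hγ⟩ := Polynomial.exists_sum_pow_ne_zero hψ hφj_irr (k := k) (by omega) S
      (by omega)
    refine Polynomial.irreducible_of_irreducible_slice hk2 (by omega) (by omega) hφK
      (Polynomial.irreducible_slice hk2 (by omega) hφK γ hj3 ?_ hγ)
    rwa [Polynomial.coeff_map, map_ne_zero_iff _ hinj]
  · obtain ⟨N₀, hN₀⟩ := Polynomial.exists_eval_sum_eq_zero hk2
    obtain ⟨m, hm, hmN⟩ := hexc.2.exists_gt N₀
    have : NeZero m := ⟨by omega⟩
    let M := FiniteField.Extension L 2 m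
    have : Fintype M := Fintype.ofFinite M
    have hM : Fintype.card M = Fintype.card L ^ m := by
      rw [Fintype.card_eq_nat_card, Fintype.card_eq_nat_card, FiniteField.natCard_extension]
    have : CharP M 2 := charP_of_injective_algebraMap (FaithfulSMul.algebraMap_injective L M) 2
    let ι : M →ₐ[L] K := IsAlgClosed.lift
    let _ : Algebra M K := ι.toAlgebra
    have hinjM := FaithfulSMul.algebraMap_injective L M
    have hφM : delta3 M * MvPolynomial.map (algebraMap L M) φ =
        phiNum (Polynomial.X ^ (2 ^ k + 1) + g.map (algebraMap L M)) := by
      rw [← Polynomial.algebraMap_delta3 (M := L), ← map_mul, hφ, Polynomial.algebraMap_phiNum]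
      simp
    obtain ⟨x, a, b, ha, hb, hab, h⟩ := hN₀ (n * m) (hmN.le.trans (Nat.le_mul_of_pos_left m hn)) M K
      (by rw [hM, hcard, pow_mul]) (g.map (algebraMap L M))
      (by rwa [Polynomial.natDegree_map_eq_of_injective hinjM]) j hj3
      (by rwa [Polynomial.coeff_map, map_ne_zero_iff _ hinjM]) _ hψ hφj_irr _ hφM
    refine not_isAPN_of_sum_eq_zero (x := x) ha hb hab ?_ (hm M (algebraMap L M) hM)
    simpa using h
end

section
/- Let L = F_q with q = 2^n, let k ≥ 2, and let f(x) = x^{2^k+1} + h(x) ∈ L[x] where h is a polynomial with 3 ≤ deg(h) < 2^k+1 and deg(h) ≡ 3 (mod 4). Then φ(x,y,z) is absolutely irreducible. -/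
open MvPolynomial

/-- The algebra map `x_i ↦ x_i T`, whose coefficient at `T ^ n` is the homogeneous part of
degree `n`. -/
noncomputable def gradeHom (K : Type) [CommRing K] :
    MvPolynomial (Fin 3) K →ₐ[K] Polynomial (MvPolynomial (Fin 3) K) :=
  aeval fun i => Polynomial.X * Polynomial.C (X i)

/-- Restriction to the line `(T, 1, 1)`. -/
noncomputable def lineHom (K : Type) [CommRing K] : MvPolynomial (Fin 3) K →ₐ[K] Polynomial K :=
  aeval ![Polynomial.X, 1, 1]

/-- The power sum `x^j + y^j + z^j + (x+y+z)^j`. -/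
noncomputable def powNum (K : Type) [CommRing K] (j : ℕ) : MvPolynomial (Fin 3) K :=
  X 0 ^ j + X 1 ^ j + X 2 ^ j + (X 0 + X 1 + X 2) ^ j

theorem Polynomial.coeff_mul_of_gap {R : Type*} [CommSemiring R] {A B : Polynomial R} {i : ℕ}
    (hi : 0 < i) (h : ∀ j, 0 < j → j < i → A.coeff j = 0) :
    (A * B).coeff i = A.coeff 0 * B.coeff i + A.coeff i * B.coeff 0 := by
  rw [Polynomial.coeff_mul]
  refine Finset.sum_eq_add (0, i) (i, 0) (by simp; omega) ?_ (by simp) (by simp)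
  rintro ⟨a, b⟩ hab ⟨h1, h2⟩
  rw [Finset.HasAntidiagonal.mem_antidiagonal] at hab
  simp only [ne_eq, Prod.mk.injEq] at hab h1 h2
  rw [h a (by omega) (by omega), zero_mul]

section Grading

variable {K : Type} [CommRing K]

theorem isHomogeneous_coeff_gradeHom (p : MvPolynomial (Fin 3) K) (n : ℕ) :
    ((gradeHom K p).coeff n).IsHomogeneous n := by
  induction p using MvPolynomial.induction_on generalizing n with
  | C a =>
    have : gradeHom K (C a) = Polynomial.C (C a) := by
      simp [gradeHom, MvPolynomial.algebraMap_eq]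
    rw [this, Polynomial.coeff_C]
    split_ifs with h
    · subst h; exact isHomogeneous_C _ _
    · exact isHomogeneous_zero _ _ _
  | add p q hp hq => rw [map_add, Polynomial.coeff_add]; exact (hp n).add (hq n)
  | mul_X p i hp =>
    have : gradeHom K (p * X i) = (gradeHom K p * Polynomial.C (X i)) * Polynomial.X := by
      simp [gradeHom]; ring
    rw [this]
    cases n with
    | zero => simpa using isHomogeneous_zero _ _ _
    | succ n =>
      rw [Polynomial.coeff_mul_X, Polynomial.coeff_mul_C]
      exact (hp n).mul (isHomogeneous_X K i)

theorem eval_one_gradeHom (p : MvPolynomial (Fin 3) K) :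
    (gradeHom K p).eval 1 = p := by
  induction p using MvPolynomial.induction_on with
  | C a => simp [gradeHom, MvPolynomial.algebraMap_eq]
  | add p q hp hq => rw [map_add, Polynomial.eval_add, hp, hq]
  | mul_X p i hp => rw [map_mul, Polynomial.eval_mul, hp]; simp [gradeHom]

theorem natDegree_lineHom_le {p : MvPolynomial (Fin 3) K} {n : ℕ} (hp : p.IsHomogeneous n) :
    (lineHom K p).natDegree ≤ n := by
  refine (MvPolynomial.aeval_natDegree_le (m := n) (n := 1) p hp.totalDegree_le _ ?_).trans (by simp)
  intro i
  fin_cases i <;> simp [Polynomial.natDegree_X_le]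

theorem coeff_aeval_X_mul_C (f : Polynomial K) (p : MvPolynomial (Fin 3) K) (n : ℕ) :
    (Polynomial.aeval (Polynomial.X * Polynomial.C p : Polynomial (MvPolynomial (Fin 3) K))
      f).coeff n = C (f.coeff n) * p ^ n := by
  induction f using Polynomial.induction_on' with
  | add f g hf hg => rw [map_add, Polynomial.coeff_add, hf, hg, Polynomial.coeff_add, C_add, add_mul]
  | monomial j a =>
    rw [Polynomial.aeval_monomial, mul_pow, ← Polynomial.C_pow, ← mul_assoc,
      Polynomial.coeff_mul_C, Polynomial.algebraMap_apply, Polynomial.coeff_C_mul,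
      Polynomial.coeff_X_pow, Polynomial.coeff_monomial]
    rcases eq_or_ne j n with rfl | hjn
    · simp [MvPolynomial.algebraMap_eq]
    · simp [hjn, hjn.symm]

theorem coeff_gradeHom_phiNum (f : Polynomial K) (n : ℕ) :
    (gradeHom K (phiNum f)).coeff n = C (f.coeff n) * powNum K n := by
  have h (p : MvPolynomial (Fin 3) K) (hp : gradeHom K p = Polynomial.X * Polynomial.C p) :
      (gradeHom K (Polynomial.aeval p f)).coeff n = C (f.coeff n) * p ^ n := by
    rw [← Polynomial.aeval_algHom_apply, hp, coeff_aeval_X_mul_C]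
  have hX (i : Fin 3) : gradeHom K (X i) = Polynomial.X * Polynomial.C (X i) := by
    simp [gradeHom]
  have hS : gradeHom K (X 0 + X 1 + X 2) = Polynomial.X * Polynomial.C (X 0 + X 1 + X 2) := by
    simp only [map_add, hX]; ring
  simp only [phiNum, map_add, Polynomial.coeff_add] at hS ⊢
  rw [h _ (hX 0), h _ (hX 1), h _ (hX 2), h _ (by simpa using hS), powNum]
  ring

theorem delta3_mul_coeff_gradeHom {f : Polynomial K} {φ : MvPolynomial (Fin 3) K}
    (hφ : delta3 K * φ = phiNum f) (n : ℕ) :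
    delta3 K * (gradeHom K φ).coeff n = C (f.coeff (n + 3)) * powNum K (n + 3) := by
  have hδ : gradeHom K (delta3 K) = Polynomial.C (delta3 K) * Polynomial.X ^ 3 := by
    simp [gradeHom, delta3]; ring
  rw [← coeff_gradeHom_phiNum, ← hφ, map_mul, hδ, mul_right_comm, Polynomial.coeff_mul_X_pow,
    Polynomial.coeff_C_mul]

theorem lineHom_of_delta3_mul [CharP K 2] {G : MvPolynomial (Fin 3) K} {a : K} {j : ℕ}
    (hG : delta3 K * G = C a * powNum K j) :
    (Polynomial.X + 1) ^ 2 * lineHom K G =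
      Polynomial.C (a * j) * (1 + Polynomial.X ^ (j - 1)) := by
  have h2 : (1 + 1 : Polynomial K) = 0 := CharTwo.add_self_eq_zero 1
  have h := congrArg (fun p => lineHom K (pderiv 2 p)) hG
  simp [delta3, powNum, lineHom, Derivation.leibniz, Derivation.leibniz_pow, pderiv_X, h2,
    add_assoc] at h
  rw [map_mul, map_natCast, lineHom]
  linear_combination h

end Grading

section Field

variable {K : Type} [Field K]

theorem natDegree_gradeHom_pos {p : MvPolynomial (Fin 3) K} (h0 : p ≠ 0) (hu : ¬ IsUnit p) :
    0 < (gradeHom K p).natDegree := by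
  rw [Nat.pos_iff_ne_zero]
  intro hd
  apply hu
  have hp := eval_one_gradeHom p
  rw [Polynomial.eq_C_of_natDegree_eq_zero hd, Polynomial.eval_C] at hp
  have hh := isHomogeneous_coeff_gradeHom p 0
  rw [hp] at hh
  have hc := totalDegree_eq_zero_iff_eq_C.mp (Nat.le_zero.mp hh.totalDegree_le)
  rw [hc] at h0 ⊢
  exact (IsUnit.mk0 _ (fun h => h0 (by rw [h, C_0]))).map C

theorem irreducible_X_add_X {i j : Fin 3} (hij : i ≠ j) :
    Irreducible (X i + X j : MvPolynomial (Fin 3) K) := by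
  have hc : (X i + X j : MvPolynomial (Fin 3) K).coeff (Finsupp.single i 1) = 1 := by
    rw [coeff_add, coeff_X, coeff_X, if_pos rfl, if_neg, add_zero]
    rw [Finsupp.single_left_inj one_ne_zero]
    exact hij.symm
  refine irreducible_of_totalDegree_eq_one ?_ fun x hx => isUnit_of_dvd_one (hc ▸ hx _)
  refine ((isHomogeneous_X K i).add (isHomogeneous_X K j)).totalDegree fun h => ?_
  rw [h, coeff_zero] at hc
  exact zero_ne_one hc

theorem delta3_ne_zero : delta3 K ≠ 0 :=
  mul_ne_zero (mul_ne_zero (irreducible_X_add_X (by decide)).ne_zero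
    (irreducible_X_add_X (by decide)).ne_zero) (irreducible_X_add_X (by decide)).ne_zero

theorem pderiv_powNum (i : Fin 3) (j : ℕ) :
    pderiv i (powNum K (j + 1)) = ((j : MvPolynomial (Fin 3) K) + 1) *
      (X i ^ j + (X 0 + X 1 + X 2) ^ j) := by
  fin_cases i <;> simp [powNum, Derivation.leibniz_pow, pderiv_X] <;> ring

theorem squarefree_powNum [CharP K 2] {k : ℕ} (hk : k ≠ 0) :
    Squarefree (powNum K (2 ^ k + 1)) := by
  rw [squarefree_iff_irreducible_sq_not_dvd_of_exists_irreducible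
    ⟨X 0, (X_prime (R := K) (i := (0 : Fin 3))).irreducible⟩]
  rintro p hp ⟨r, hr⟩
  have hdvd (i : Fin 3) : p ∣ pderiv i (powNum K (2 ^ k + 1)) := by
    rw [hr, Derivation.leibniz, Derivation.leibniz]
    simp only [smul_eq_mul]
    exact ⟨p * pderiv i r + r * pderiv i p + r * pderiv i p, by ring⟩
  have hpow (i : Fin 3) : p ∣ X i + (X 0 + X 1 + X 2) := by
    refine hp.prime.dvd_of_dvd_pow (n := 2 ^ k) ?_
    have h := hdvd i
    rw [pderiv_powNum, Nat.cast_pow, Nat.cast_ofNat, CharTwo.two_eq_zero, zero_pow hk, zero_add,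
      one_mul, ← add_pow_char_pow] at h
    exact h
  have h2 : (1 + 1 : MvPolynomial (Fin 3) K) = 0 := CharTwo.add_self_eq_zero 1
  have d0 : p ∣ X 1 + X 2 := by
    convert hpow 0 using 1
    linear_combination (-X 0) * h2
  have d1 : p ∣ X 0 + X 2 := by
    convert hpow 1 using 1
    linear_combination (-X 1) * h2
  have hd : (X 1 + X 2 : MvPolynomial (Fin 3) K) ∣ X 0 + X 2 :=
    (hp.dvd_symm (irreducible_X_add_X (by decide)) d0).trans d1
  have := map_dvd (aeval ![(1 : K), 0, 0]) hd
  simp at this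

theorem coeff_reverse_gradeHom_eq_zero {p : MvPolynomial (Fin 3) K} {i : ℕ} (hi : 0 < i)
    (h : (gradeHom K p).reverse.coeff 0 ∣ (gradeHom K p).reverse.coeff i) :
    (gradeHom K p).reverse.coeff i = 0 := by
  by_contra hne
  have his : i ≤ (gradeHom K p).natDegree :=
    (Polynomial.le_natDegree_of_ne_zero hne).trans (Polynomial.reverse_natDegree_le _)
  have hle := totalDegree_le_of_dvd_of_isDomain h hne
  have h0 := ne_zero_of_dvd_ne_zero hne h
  rw [Polynomial.coeff_reverse, Polynomial.revAt_le (Nat.zero_le _)] at hle h0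
  rw [Polynomial.coeff_reverse, Polynomial.revAt_le his] at hle hne
  rw [(isHomogeneous_coeff_gradeHom p _).totalDegree h0,
    (isHomogeneous_coeff_gradeHom p _).totalDegree hne] at hle
  omega

/-- If `p` and `r` have relatively prime leading forms and the `e - 1` homogeneous parts of `p * r`
just below the leading one vanish, then the same gap occurs in `p`. -/
theorem coeff_reverse_gradeHom_of_gap {p r : MvPolynomial (Fin 3) K} {e : ℕ}
    (hrel : IsRelPrime (gradeHom K p).leadingCoeff (gradeHom K r).leadingCoeff)
    (hgap : ∀ i, 0 < i → i < e → (gradeHom K (p * r)).reverse.coeff i = 0) :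
    ∀ i, 0 < i → i < e → (gradeHom K p).reverse.coeff i = 0 := by
  intro i
  induction i using Nat.strong_induction_on with
  | _ i ih =>
  intro hi hie
  apply coeff_reverse_gradeHom_eq_zero hi
  have h := hgap i hi hie
  rw [map_mul, Polynomial.reverse_mul_of_domain,
    Polynomial.coeff_mul_of_gap hi fun j hj hji => ih j hji hj (hji.trans hie)] at h
  rw [← Polynomial.coeff_zero_reverse, ← Polynomial.coeff_zero_reverse] at hrel
  refine hrel.dvd_of_dvd_mul_right ?_
  rw [eq_neg_of_add_eq_zero_right h]
  exact (dvd_mul_right _ _).neg_right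

theorem lineHom_eval_one_eq_zero {a b : MvPolynomial (Fin 3) K} {s t : ℕ} (hs : 0 < s)
    (ha : a.IsHomogeneous s) (hb : b.IsHomogeneous t)
    (hab : lineHom K (a * b) = (Polynomial.X - Polynomial.C 1) ^ (s + t)) :
    (lineHom K a).eval 1 = 0 := by
  have hX : (Polynomial.X - Polynomial.C (1 : K)) ≠ 0 := Polynomial.X_sub_C_ne_zero 1
  rw [map_mul] at hab
  have hne : lineHom K a * lineHom K b ≠ 0 := hab ▸ pow_ne_zero _ hX
  have hdeg := congrArg Polynomial.natDegree hab
  rw [Polynomial.natDegree_mul (left_ne_zero_of_mul hne) (right_ne_zero_of_mul hne),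
    Polynomial.natDegree_pow, Polynomial.natDegree_X_sub_C] at hdeg
  have h1 := natDegree_lineHom_le ha
  have h2 := natDegree_lineHom_le hb
  obtain ⟨i, -, hi⟩ := (dvd_prime_pow (Polynomial.prime_X_sub_C (1 : K)) _).mp
    (Dvd.intro _ hab)
  have hi0 : i ≠ 0 := by
    rintro rfl
    have := Polynomial.natDegree_eq_zero_of_isUnit
      (associated_one_iff_isUnit.mp (by simpa using hi))
    omega
  exact (Polynomial.dvd_iff_isRoot.mp ((dvd_pow_self _ hi0).trans hi.symm.dvd))

theorem lineHom_of_delta3_mul_gold [CharP K 2] {G : MvPolynomial (Fin 3) K} {k N : ℕ}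
    (hN : 2 ^ k = N + 2) (hG : delta3 K * G = powNum K (N + 3)) :
    lineHom K G = (Polynomial.X - Polynomial.C 1) ^ N := by
  have h := lineHom_of_delta3_mul (a := 1) (hG.trans (by rw [C_1, one_mul]))
  have hodd : ((N + 3 : ℕ) : K) = 1 := by
    have h2 : ((N + 2 : ℕ) : K) = 0 := by
      have hk : k ≠ 0 := by rintro rfl; omega
      rw [← hN, Nat.cast_pow, Nat.cast_ofNat, CharTwo.two_eq_zero, zero_pow hk]
    rw [Nat.cast_succ, h2, zero_add]
  have hfrob : (1 + Polynomial.X ^ (N + 2) : Polynomial K) = (Polynomial.X + 1) ^ (N + 2) := by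
    rw [← hN, add_pow_char_pow, one_pow, add_comm]
  have hX : (Polynomial.X + 1 : Polynomial K) = Polynomial.X - Polynomial.C 1 := by
    rw [CharTwo.sub_eq_add, Polynomial.C_1]
  rw [hodd, mul_one, Polynomial.C_1, one_mul, show N + 3 - 1 = N + 2 from rfl, hfrob, pow_add,
    mul_comm, hX] at h
  exact mul_right_cancel₀ (pow_ne_zero 2 (Polynomial.X_sub_C_ne_zero 1)) h

theorem irreducible_of_delta3_mul [CharP K 2] {k : ℕ} (hk : 2 ≤ k) {h : Polynomial K}
    (hh3 : 3 ≤ h.natDegree) (hhlt : h.natDegree < 2 ^ k + 1) (hhmod : h.natDegree % 4 = 3)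
    {φ : MvPolynomial (Fin 3) K} (hφ : delta3 K * φ = phiNum (Polynomial.X ^ (2 ^ k + 1) + h)) :
    Irreducible φ := by
  have hk4 : 2 ^ 2 ≤ 2 ^ k := Nat.pow_le_pow_right two_pos hk
  obtain ⟨N, hN⟩ : ∃ N, 2 ^ k = N + 2 := ⟨2 ^ k - 2, by omega⟩
  obtain ⟨m, hm⟩ : ∃ m, h.natDegree = 4 * m + 3 := ⟨h.natDegree / 4, by omega⟩
  rw [show 2 ^ k + 1 = N + 3 by omega] at hφ
  have hcoef := delta3_mul_coeff_gradeHom hφ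
  have hodd {j : ℕ} (hj : Odd j) : (j : K) = 1 := by
    obtain ⟨c, rfl⟩ := hj
    simp [CharTwo.two_eq_zero]
  have hXC : (Polynomial.X + 1 : Polynomial K) = Polynomial.X - Polynomial.C 1 := by
    rw [CharTwo.sub_eq_add, Polynomial.C_1]
  have hX1 : (Polynomial.X + 1 : Polynomial K) ≠ 0 := hXC ▸ Polynomial.X_sub_C_ne_zero 1
  have hhigh (n : ℕ) (hn : 4 * m < n) (hnN : n ≠ N) : (gradeHom K φ).coeff n = 0 := by
    have := hcoef n
    rw [Polynomial.coeff_add, Polynomial.coeff_X_pow, if_neg (by omega),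
      Polynomial.coeff_eq_zero_of_natDegree_lt (p := h) (by omega)] at this
    simpa [delta3_ne_zero] using this
  have htop : delta3 K * (gradeHom K φ).coeff N = powNum K (N + 3) := by
    rw [hcoef, Polynomial.coeff_add, Polynomial.coeff_X_pow, if_pos rfl,
      Polynomial.coeff_eq_zero_of_natDegree_lt (p := h) (by omega), add_zero, C_1, one_mul]
  have hlineN : lineHom K ((gradeHom K φ).coeff N) = (Polynomial.X - Polynomial.C 1) ^ N :=
    lineHom_of_delta3_mul_gold hN htop
  have hNne : (gradeHom K φ).coeff N ≠ 0 := by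
    intro h0
    rw [h0, map_zero] at hlineN
    exact pow_ne_zero N (Polynomial.X_sub_C_ne_zero (1 : K)) hlineN.symm
  have hdeg : (gradeHom K φ).natDegree = N := by
    refine le_antisymm (Polynomial.natDegree_le_iff_coeff_eq_zero.mpr fun n hn => ?_)
      (Polynomial.le_natDegree_of_ne_zero hNne)
    exact hhigh n (by omega) (by omega)
  have hlow : (lineHom K ((gradeHom K φ).coeff (4 * m))).eval 1 ≠ 0 := by
    have h1 := lineHom_of_delta3_mul (hcoef (4 * m))
    have hcd : (Polynomial.X ^ (N + 3) + h).coeff (4 * m + 3) = h.leadingCoeff := by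
      rw [Polynomial.coeff_add, Polynomial.coeff_X_pow, if_neg (by omega), zero_add,
        Polynomial.leadingCoeff, hm]
    have hgs : (1 + Polynomial.X ^ (4 * m + 3 - 1) : Polynomial K) =
        (Polynomial.X + 1) ^ 2 * (∑ i ∈ Finset.range (2 * m + 1), Polynomial.X ^ i) ^ 2 := by
      rw [← mul_pow, hXC, Polynomial.C_1, mul_geom_sum, CharTwo.sub_eq_add,
        CharTwo.add_sq, ← pow_mul, one_pow, add_comm, show (2 * m + 1) * 2 = 4 * m + 3 - 1 by omega]
    rw [hcd, hodd ⟨2 * m + 1, by ring⟩, hgs, mul_left_comm] at h1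
    rw [mul_left_cancel₀ (pow_ne_zero 2 hX1) h1]
    have h2 := hodd (j := 2 * m + 1) ⟨m, rfl⟩
    push_cast at h2
    have hh0 : h ≠ 0 := by
      rintro rfl
      simp at hh3
    simp [Polynomial.eval_finsetSum, h2, hh0]
  have hN4 : 4 * m < N := by omega
  refine ⟨fun hu => ?_, fun p r hpr => ?_⟩
  · have := Polynomial.natDegree_eq_zero_of_isUnit (hu.map (gradeHom K))
    omega
  by_contra! hpru
  obtain ⟨hpu, hru⟩ := hpru
  have hφ0 : φ ≠ 0 := by
    rintro rfl
    simp at hNne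
  have hp0 : p ≠ 0 := by rintro rfl; simp [hpr] at hφ0
  have hr0 : r ≠ 0 := by rintro rfl; simp [hpr] at hφ0
  have hs := natDegree_gradeHom_pos hp0 hpu
  have ht := natDegree_gradeHom_pos hr0 hru
  have hlead : (gradeHom K p).leadingCoeff * (gradeHom K r).leadingCoeff =
      (gradeHom K φ).coeff N := by
    rw [← Polynomial.leadingCoeff_mul, ← map_mul, ← hpr, Polynomial.leadingCoeff, hdeg]
  have hst : (gradeHom K p).natDegree + (gradeHom K r).natDegree = N := by
    rw [← hdeg, hpr, map_mul, Polynomial.natDegree_mul']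
    rw [hlead]; exact hNne
  have hrel : IsRelPrime (gradeHom K p).leadingCoeff (gradeHom K r).leadingCoeff := by
    apply IsRelPrime.of_squarefree_mul
    rw [hlead]
    have hsq := squarefree_powNum (K := K) (by omega : k ≠ 0)
    rw [hN] at hsq
    exact hsq.squarefree_of_dvd (Dvd.intro_left _ htop)
  have hpgap := coeff_reverse_gradeHom_of_gap (e := N - 4 * m) hrel fun i hi hie => by
    rw [← hpr, Polynomial.coeff_reverse, hdeg, Polynomial.revAt_le (by omega)]
    exact hhigh _ (by omega) (by omega)
  have hsum : (gradeHom K φ).coeff (4 * m) =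
      (gradeHom K p).leadingCoeff * (gradeHom K r).reverse.coeff (N - 4 * m) +
      (gradeHom K p).reverse.coeff (N - 4 * m) * (gradeHom K r).leadingCoeff := by
    rw [← Polynomial.coeff_zero_reverse, ← Polynomial.coeff_zero_reverse,
      ← Polynomial.coeff_mul_of_gap (by omega) hpgap, ← Polynomial.reverse_mul_of_domain,
      ← map_mul, ← hpr, Polynomial.coeff_reverse, hdeg, Polynomial.revAt_le (by omega)]
    congr 1
    omega
  have hp1 := lineHom_eval_one_eq_zero hs (isHomogeneous_coeff_gradeHom p _)
    (isHomogeneous_coeff_gradeHom r _) (by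
      rw [hst, ← hlineN, ← hlead, Polynomial.leadingCoeff, Polynomial.leadingCoeff])
  have hr1 := lineHom_eval_one_eq_zero ht (isHomogeneous_coeff_gradeHom r _)
    (isHomogeneous_coeff_gradeHom p _) (by
      rw [add_comm, hst, ← hlineN, ← hlead, mul_comm, Polynomial.leadingCoeff,
        Polynomial.leadingCoeff])
  apply hlow
  rw [Polynomial.coeff_natDegree] at hp1 hr1
  rw [hsum]
  simp [hp1, hr1]

end Field

theorem map_phiNum {L K : Type} [CommRing L] [CommRing K] [Algebra L K] (f : Polynomial L) :
    MvPolynomial.map (algebraMap L K) (phiNum f) = phiNum (f.map (algebraMap L K)) := by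
  have h (p : MvPolynomial (Fin 3) L) : MvPolynomial.map (algebraMap L K) (Polynomial.aeval p f) =
      Polynomial.aeval (MvPolynomial.map (algebraMap L K) p) (f.map (algebraMap L K)) := by
    rw [Polynomial.aeval_def, Polynomial.aeval_def, Polynomial.hom_eval₂, Polynomial.eval₂_map]
    congr 1
    ext
    simp [MvPolynomial.algebraMap_eq]
  simp [phiNum, h]

/-- Let `L = F_q`, `q = 2^n`, `k ≥ 2`, and `f(x) = x^{2^k+1} + h(x)`
with `3 ≤ deg h < 2^k + 1` and `deg h ≡ 3 (mod 4)`. Then `φ` is absolutely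
irreducible. -/
theorem gold_plus_deg_three_mod_four_abs_irred {n : ℕ} (hn : 0 < n) (L : Type)
    [Field L] [Fintype L] (hcard : Fintype.card L = 2 ^ n)
    (k : ℕ) (hk : 2 ≤ k) (h : Polynomial L)
    (hh3 : 3 ≤ h.natDegree) (hhlt : h.natDegree < 2 ^ k + 1)
    (hhmod : h.natDegree % 4 = 3)
    (f : Polynomial L) (hf : f = Polynomial.X ^ (2 ^ k + 1) + h)
    (φ : MvPolynomial (Fin 3) L) (hφ : delta3 L * φ = phiNum f) :
    AbsolutelyIrreducible φ := by
  have : Fact (Nat.Prime 2) := ⟨Nat.prime_two⟩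
  have : CharP L 2 := charP_of_card_eq_prime_pow hcard
  have : CharP (AlgebraicClosure L) 2 :=
    charP_of_injective_algebraMap (algebraMap L (AlgebraicClosure L)).injective 2
  subst hf
  have hd := Polynomial.natDegree_map (p := h) (algebraMap L (AlgebraicClosure L))
  refine irreducible_of_delta3_mul hk (h := h.map (algebraMap L (AlgebraicClosure L)))
    (by rwa [hd]) (by rwa [hd]) (by rwa [hd]) ?_
  have := congrArg (MvPolynomial.map (algebraMap L (AlgebraicClosure L))) hφ
  rw [map_phiNum, map_mul] at this
  simpa [delta3] using this
end
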